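/- Consider a compound discrete memoryless channel with two components: finite alphabets 𝒳, 𝒮, 𝒴, channels W₁, W₂ : 𝒳 → 𝒮 → PMF 𝒴 and a state distribution P_S : PMF 𝒮, where the state sequence is known non-causally at the transmitter only. Let 𝒰, 𝒱₁, 𝒱₂ be nonempty finite sets and P : 𝒮 → PMF (𝒳 × 𝒰 × 𝒱₁ × 𝒱₂) any conditional input distribution; for θ ∈ {1,2} define the joint pmf p_θ(u,v₁,v₂,s,x,y) = P_S(s) · P(s)(x,u,v₁,v₂) · (W_θ x s)(y). Then the rate R = max(0, min{ I(U,V₁;Y₁) − I(U,V₁;S), I(U,V₂;Y₂) − I(U,V₂;S), ½[ I(U,V₁;Y₁) − I(U,V₁;S) + I(U,V₂;Y₂) − I(U,V₂;S) − I(V₁;V₂ | U,S) ] }) is achievable, where all informations are computed from p₁ and p₂ (quantities not involving Y do not depend on θ). -/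

import Mathlib

open scoped BigOperators

noncomputable section

namespace CompoundTwo

variable {𝒳 𝒮 𝒴 : Type} [Fintype 𝒳] [Fintype 𝒮] [Fintype 𝒴]

/-- Mutual information `I(A;B)` of a joint (real-valued) pmf `p` on `A × B`,
with natural logarithm and the convention `0·log(·) = 0`. -/
def mutualInfo {A B : Type} [Fintype A] [Fintype B] (p : A × B → ℝ) : ℝ :=
  ∑ a : A, ∑ b : B,
    p (a, b) *
      Real.log (p (a, b) / ((∑ b' : B, p (a, b')) * (∑ a' : A, p (a', b))))

/-- Conditional mutual information `I(A;B|C)` of a joint pmf `p` on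
`A × B × C`: `I(A;B|C) = Σ p(a,b,c)·log( p(a,b,c)·p_C(c) / (p_{AC}(a,c)·p_{BC}(b,c)) )`,
which equals `Σ_c p_C(c)·I(A;B|C=c)` under the convention `0·log(·) = 0`. -/
def condMutualInfo {A B C : Type} [Fintype A] [Fintype B] [Fintype C]
    (p : A × B × C → ℝ) : ℝ :=
  ∑ a : A, ∑ b : B, ∑ c : C,
    p (a, b, c) *
      Real.log ((p (a, b, c) * (∑ a' : A, ∑ b' : B, p (a', b', c))) /
        ((∑ b' : B, p (a, b', c)) * (∑ a' : A, p (a', b, c))))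

/-- Average (over i.i.d. states with pmf `PS`) error probability of message `m`
for the channel component `θ`, for the `(n,M)` code `(φ, ψ)`. -/
def avgError {Θ : Type} (W : Θ → 𝒳 → 𝒮 → PMF 𝒴) (PS : PMF 𝒮) {n M : ℕ}
    (φ : Fin M → (Fin n → 𝒮) → (Fin n → 𝒳)) (ψ : (Fin n → 𝒴) → Fin M)
    (m : Fin M) (θ : Θ) : ℝ :=
  ∑ s : Fin n → 𝒮, (∏ i, (PS (s i)).toReal) *
    ∑ y : Fin n → 𝒴,
      (∏ i, ((W θ (φ m s i) (s i)) (y i)).toReal) * (if ψ y ≠ m then 1 else 0)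

/-- `R` is an achievable rate for the compound DMC `{W θ}` with i.i.d. states
(pmf `PS`) known non-causally at the transmitter only. -/
def IsAchievable {Θ : Type} (W : Θ → 𝒳 → 𝒮 → PMF 𝒴) (PS : PMF 𝒮) (R : ℝ) : Prop :=
  0 ≤ R ∧
    ∀ ε ∈ Set.Ioo (0 : ℝ) 1, ∀ γ ∈ Set.Ioo (0 : ℝ) 1, ∃ n₀ : ℕ, ∀ n ≥ n₀,
      ∃ M : ℕ, 1 ≤ M ∧
        ∃ (φ : Fin M → (Fin n → 𝒮) → (Fin n → 𝒳)) (ψ : (Fin n → 𝒴) → Fin M),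
          Real.log M / n ≥ R - γ ∧ ∀ m θ, avgError W PS φ ψ m θ ≤ ε

/-- The joint pmf `p_θ(u,v₁,v₂,s,x,y) = P_S(s)·P(s)(x,u,v₁,v₂)·(W_θ x s)(y)`
(as a real-valued function), for a two-component compound DMC. -/
def joint {𝒰 𝒱₁ 𝒱₂ : Type} (Wθ : 𝒳 → 𝒮 → PMF 𝒴) (PS : PMF 𝒮)
    (P : 𝒮 → PMF (𝒳 × 𝒰 × 𝒱₁ × 𝒱₂)) :
    𝒰 × 𝒱₁ × 𝒱₂ × 𝒮 × 𝒳 × 𝒴 → ℝ :=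
  fun q =>
    (PS q.2.2.2.1).toReal * ((P q.2.2.2.1) (q.2.2.2.2.1, q.1, q.2.1, q.2.2.1)).toReal *
      ((Wθ q.2.2.2.2.1 q.2.2.2.1) q.2.2.2.2.2).toReal

lemma sum_pi_prod {A : Type} [Fintype A] {L : ℕ} (g : Fin L → A → ℝ) :
    ∑ c : Fin L → A, ∏ i, g i (c i) = ∏ i, ∑ a, g i a := by
  classical
  rw [Finset.prod_univ_sum, Fintype.piFinset_univ]

lemma pi_nonneg {A : Type} {L : ℕ} {μ : A → ℝ} (h0 : ∀ a, 0 ≤ μ a) (c : Fin L → A) :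
    0 ≤ ∏ i, μ (c i) := Finset.prod_nonneg fun _ _ => h0 _

lemma pi_sum_one {A : Type} [Fintype A] {L : ℕ} {μ : A → ℝ} (h1 : ∑ a, μ a = 1) :
    ∑ c : Fin L → A, ∏ i, μ (c i) = 1 := by
  rw [sum_pi_prod (fun _ => μ)]; simp [h1]

lemma pi_marg {A : Type} [Fintype A] {L : ℕ} {μ : A → ℝ} (h1 : ∑ a, μ a = 1)
    (h : A → ℝ) (j : Fin L) :
    ∑ c : Fin L → A, (∏ i, μ (c i)) * h (c j) = ∑ a, μ a * h a := by
  have : ∀ c : Fin L → A, (∏ i, μ (c i)) * h (c j)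
      = ∏ i, (μ (c i) * (if i = j then h (c i) else 1)) := by
    intro c
    rw [Finset.prod_mul_distrib, Finset.prod_ite_eq']
    simp
  simp_rw [this]
  rw [sum_pi_prod (fun i a => μ a * (if i = j then h a else 1))]
  rw [Finset.prod_eq_single j]
  · simp
  · intro b _ hb; simp [hb, h1]
  · simp

lemma pi_marg2 {A : Type} [Fintype A] {L : ℕ} {μ : A → ℝ} (h1 : ∑ a, μ a = 1)
    (h : A → ℝ) (i j : Fin L) (hij : i ≠ j) :
    ∑ c : Fin L → A, (∏ k, μ (c k)) * (h (c i) * h (c j)) = (∑ a, μ a * h a) ^ 2 := by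
  have : ∀ c : Fin L → A, (∏ k, μ (c k)) * (h (c i) * h (c j))
      = ∏ k, (μ (c k) * (if k = i then h (c k) else 1) * (if k = j then h (c k) else 1)) := by
    intro c
    rw [Finset.prod_mul_distrib, Finset.prod_mul_distrib, Finset.prod_ite_eq',
      Finset.prod_ite_eq']
    simp [mul_assoc]
  simp_rw [this]
  rw [sum_pi_prod (fun k a => μ a * (if k = i then h a else 1) * (if k = j then h a else 1))]
  have h2 : ∀ k, ∑ a, μ a * (if k = i then h a else 1) * (if k = j then h a else 1)
      = (if k = i then ∑ a, μ a * h a else 1) * (if k = j then ∑ a, μ a * h a else 1) := by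
    intro k
    by_cases hi : k = i
    · subst hi; simp [hij]
    · by_cases hj : k = j
      · subst hj; simp [hi]
      · simp [hi, hj, h1]
  simp_rw [h2]
  rw [Finset.prod_mul_distrib, Finset.prod_ite_eq', Finset.prod_ite_eq']
  simp [sq]

lemma iid2 {A : Type} [Fintype A] {L : ℕ} (hL : 0 < L) {μ : A → ℝ} (_h0 : ∀ a, 0 ≤ μ a)
    (h1 : ∑ a, μ a = 1) (h : A → ℝ) :
    ∑ c : Fin L → A, (∏ i, μ (c i)) * ((∑ i, h (c i)) / L) ^ 2
      ≤ (∑ a, μ a * h a) ^ 2 + (∑ a, μ a * h a ^ 2) / L := by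
  have hL' : (0 : ℝ) < L := by exact_mod_cast hL
  have e1 : ∑ c : Fin L → A, (∏ i, μ (c i)) * ((∑ i, h (c i)) / L) ^ 2
      = (∑ i, ∑ j, ∑ c : Fin L → A, (∏ k, μ (c k)) * (h (c i) * h (c j))) / L ^ 2 := by
    have : ∀ c : Fin L → A, (∏ i, μ (c i)) * ((∑ i, h (c i)) / L) ^ 2
       = (∑ i, ∑ j, (∏ k, μ (c k)) * (h (c i) * h (c j))) / L ^ 2 := by
      intro c
      rw [div_pow, sq (∑ i, h (c i)), Finset.sum_mul_sum, ← mul_div_assoc, Finset.mul_sum]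
      simp_rw [Finset.mul_sum]
    simp_rw [this]
    rw [← Finset.sum_div, Finset.sum_comm]
    congr 1
    refine Finset.sum_congr rfl fun i _ => ?_
    rw [Finset.sum_comm]
  rw [e1]
  set E := ∑ a, μ a * h a
  set F := ∑ a, μ a * h a ^ 2
  have e2 : ∀ i j : Fin L, ∑ c : Fin L → A, (∏ k, μ (c k)) * (h (c i) * h (c j))
      ≤ E ^ 2 + (if i = j then F else 0) := by
    intro i j
    by_cases hij : i = j
    · subst hij
      have := pi_marg h1 (fun a => h a * h a) i
      rw [this]
      simp only [if_true]
      have : ∑ a, μ a * (h a * h a) = F := by simp [F, sq]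
      rw [this]; nlinarith [sq_nonneg E]
    · rw [pi_marg2 h1 h i j hij]; simp [hij, E]
  have e3 : ∑ i : Fin L, ∑ j : Fin L, ∑ c : Fin L → A, (∏ k, μ (c k)) * (h (c i) * h (c j))
      ≤ L ^ 2 * E ^ 2 + L * F := by
    calc _ ≤ ∑ i : Fin L, ∑ j : Fin L, (E ^ 2 + (if i = j then F else 0)) :=
          Finset.sum_le_sum fun i _ => Finset.sum_le_sum fun j _ => e2 i j
      _ = _ := by simp [Finset.sum_add_distrib]; ring
  calc _ ≤ (L ^ 2 * E ^ 2 + L * F) / L ^ 2 := by gcongr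
    _ = _ := by field_simp

lemma iid2d {A B : Type} [Fintype A] [Fintype B] {L1 L2 : ℕ} (hL1 : 0 < L1) (hL2 : 0 < L2)
    {k1 : A → ℝ} (h10 : ∀ a, 0 ≤ k1 a) (h11 : ∑ a, k1 a = 1)
    {k2 : B → ℝ} (h20 : ∀ a, 0 ≤ k2 a) (h21 : ∑ a, k2 a = 1) (g : A → B → ℝ) :
    ∑ a : Fin L1 → A, ∑ b : Fin L2 → B, (∏ i, k1 (a i)) * (∏ j, k2 (b j)) *
       ((∑ i, ∑ j, g (a i) (b j)) / (L1 * L2)) ^ 2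
      ≤ (∑ x, ∑ y, k1 x * k2 y * g x y) ^ 2 + (∑ y, k2 y * (∑ x, k1 x * g x y) ^ 2) / L2
        + (∑ x, k1 x * (∑ y, k2 y * g x y) ^ 2) / L1
        + (∑ x, ∑ y, k1 x * k2 y * g x y ^ 2) / (L1 * L2) := by
  have s1 : ∀ b : Fin L2 → B, ∑ a : Fin L1 → A, (∏ i, k1 (a i)) *
       ((∑ i, ∑ j, g (a i) (b j)) / (L1 * L2)) ^ 2
       ≤ ((∑ j, ∑ x, k1 x * g x (b j)) / L2) ^ 2
        + (∑ x, k1 x * ((∑ j, g x (b j)) / L2) ^ 2) / L1 := by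
    intro b
    have := iid2 hL1 h10 h11 (fun x => (∑ j, g x (b j)) / L2)
    refine le_trans (le_of_eq ?_) (le_trans this (le_of_eq ?_))
    · refine Finset.sum_congr rfl fun a _ => ?_
      rw [← Finset.sum_div, div_div, mul_comm (L2 : ℝ)]
    · congr 2
      rw [Finset.sum_comm, Finset.sum_div]
      refine Finset.sum_congr rfl fun a _ => ?_
      rw [← Finset.mul_sum, mul_div_assoc]
  have s2 := iid2 hL2 h20 h21 (fun y => ∑ x, k1 x * g x y)
  have s3 : ∀ x, _ := fun x => iid2 hL2 h20 h21 (fun y => g x y)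
  calc _ = ∑ b : Fin L2 → B, (∏ j, k2 (b j)) * ∑ a : Fin L1 → A, (∏ i, k1 (a i)) *
       ((∑ i, ∑ j, g (a i) (b j)) / (L1 * L2)) ^ 2 := by
        rw [Finset.sum_comm]
        refine Finset.sum_congr rfl fun b _ => ?_
        rw [Finset.mul_sum]
        refine Finset.sum_congr rfl fun a _ => ?_
        ring
    _ ≤ ∑ b : Fin L2 → B, (∏ j, k2 (b j)) * (((∑ j, ∑ x, k1 x * g x (b j)) / L2) ^ 2
        + (∑ x, k1 x * ((∑ j, g x (b j)) / L2) ^ 2) / L1) :=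
        Finset.sum_le_sum fun b _ => mul_le_mul_of_nonneg_left (s1 b) (pi_nonneg h20 b)
    _ = ∑ b : Fin L2 → B, (∏ j, k2 (b j)) * ((∑ j, ∑ x, k1 x * g x (b j)) / L2) ^ 2
        + (∑ x, k1 x * ∑ b : Fin L2 → B, (∏ j, k2 (b j)) * ((∑ j, g x (b j)) / L2) ^ 2) / L1 := by
        simp_rw [mul_add]
        rw [Finset.sum_add_distrib]
        congr 1
        simp_rw [Finset.mul_sum, ← mul_div_assoc]
        rw [← Finset.sum_div]
        congr 1
        simp_rw [Finset.mul_sum]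
        rw [Finset.sum_comm]
        refine Finset.sum_congr rfl fun b _ => Finset.sum_congr rfl fun a _ => ?_
        ring
    _ ≤ ((∑ y, k2 y * ∑ x, k1 x * g x y) ^ 2 + (∑ y, k2 y * (∑ x, k1 x * g x y) ^ 2) / L2)
        + (∑ x, k1 x * ((∑ y, k2 y * g x y) ^ 2 + (∑ y, k2 y * g x y ^ 2) / L2)) / L1 := by
        refine add_le_add s2 ?_
        gcongr with x hx
        · exact h10 x
        · exact s3 x
    _ = _ := by
        simp_rw [mul_add]
        rw [Finset.sum_add_distrib, add_div]
        have t1 : ∑ y, k2 y * ∑ x, k1 x * g x y = ∑ x, ∑ y, k1 x * k2 y * g x y := by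
          simp_rw [Finset.mul_sum]
          rw [Finset.sum_comm]
          refine Finset.sum_congr rfl fun b _ => Finset.sum_congr rfl fun a _ => ?_
          ring
        have t2 : (∑ x, k1 x * ((∑ y, k2 y * g x y ^ 2) / L2)) / L1
            = (∑ x, ∑ y, k1 x * k2 y * g x y ^ 2) / (L1 * L2) := by
          rw [mul_comm (L1 : ℝ), ← div_div, Finset.sum_div (f := fun x => ∑ y, k1 x * k2 y * g x y ^ 2)]
          congr 1
          refine Finset.sum_congr rfl fun b _ => ?_
          rw [← mul_div_assoc, Finset.mul_sum]
          simp_rw [mul_assoc]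
        rw [t1, t2]; ring

/-- Distribution of one block of the codebook. -/
def Q0 {U V1 V2 : Type} {L1 L2 : ℕ} (pU : U → ℝ) (k1 : U → V1 → ℝ) (k2 : U → V2 → ℝ) :
    U × (Fin L1 → V1) × (Fin L2 → V2) → ℝ :=
  fun b => pU b.1 * ((∏ i, k1 b.1 (b.2.1 i)) * ∏ j, k2 b.1 (b.2.2 j))

lemma Q0_nonneg {U V1 V2 : Type} {L1 L2 : ℕ} {pU : U → ℝ} {k1 : U → V1 → ℝ} {k2 : U → V2 → ℝ}
    (hU : ∀ u, 0 ≤ pU u) (h1 : ∀ u v, 0 ≤ k1 u v) (h2 : ∀ u v, 0 ≤ k2 u v)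
    (b : U × (Fin L1 → V1) × (Fin L2 → V2)) : 0 ≤ Q0 pU k1 k2 b :=
  mul_nonneg (hU _) (mul_nonneg (pi_nonneg (h1 _) _) (pi_nonneg (h2 _) _))

lemma Q0_sum {U V1 V2 : Type} [Fintype U] [Fintype V1] [Fintype V2] {L1 L2 : ℕ}
    {pU : U → ℝ} {k1 : U → V1 → ℝ} {k2 : U → V2 → ℝ}
    (f : U × (Fin L1 → V1) × (Fin L2 → V2) → ℝ) :
    ∑ b, Q0 pU k1 k2 b * f b = ∑ u, pU u * ∑ a : Fin L1 → V1, ∑ b : Fin L2 → V2,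
      (∏ i, k1 u (a i)) * (∏ j, k2 u (b j)) * f (u, a, b) := by
  simp_rw [Fintype.sum_prod_type, Q0, Finset.mul_sum]
  refine Finset.sum_congr rfl fun u _ => Finset.sum_congr rfl fun a _ =>
    Finset.sum_congr rfl fun b _ => ?_
  ring

lemma pi2_marg {A B : Type} [Fintype A] [Fintype B] {L1 L2 : ℕ}
    {k1 : A → ℝ} (h11 : ∑ a, k1 a = 1) {k2 : B → ℝ} (h21 : ∑ a, k2 a = 1) (g : A → B → ℝ)
    (i : Fin L1) (j : Fin L2) :
    ∑ a : Fin L1 → A, ∑ b : Fin L2 → B, (∏ i, k1 (a i)) * (∏ j, k2 (b j)) * g (a i) (b j)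
      = ∑ x, ∑ y, k1 x * k2 y * g x y := by
  have : ∀ a : Fin L1 → A, ∑ b : Fin L2 → B, (∏ i, k1 (a i)) * (∏ j, k2 (b j)) * g (a i) (b j)
      = (∏ i, k1 (a i)) * ∑ y, k2 y * g (a i) y := by
    intro a
    rw [← pi_marg h21 (fun y => g (a i) y) j, Finset.mul_sum]
    simp_rw [mul_assoc]
  simp_rw [this]
  rw [pi_marg h11 (fun x => ∑ y, k2 y * g x y) i]
  simp_rw [Finset.mul_sum, mul_assoc]

lemma pi2_one {A B : Type} [Fintype A] [Fintype B] {L1 L2 : ℕ}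
    {k1 : A → ℝ} (h11 : ∑ a, k1 a = 1) {k2 : B → ℝ} (h21 : ∑ a, k2 a = 1) :
    ∑ a : Fin L1 → A, ∑ b : Fin L2 → B, (∏ i, k1 (a i)) * (∏ j, k2 (b j)) = 1 := by
  simp_rw [← Finset.mul_sum, pi_sum_one h21, mul_one, pi_sum_one h11]

lemma Q0_one {U V1 V2 : Type} [Fintype U] [Fintype V1] [Fintype V2] {L1 L2 : ℕ}
    {pU : U → ℝ} {k1 : U → V1 → ℝ} {k2 : U → V2 → ℝ}
    (hU1 : ∑ u, pU u = 1) (h11 : ∀ u, ∑ v, k1 u v = 1) (h21 : ∀ u, ∑ v, k2 u v = 1) :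
    ∑ b : U × (Fin L1 → V1) × (Fin L2 → V2), Q0 pU k1 k2 b = 1 := by
  have := Q0_sum (pU := pU) (k1 := k1) (k2 := k2) (L1 := L1) (L2 := L2) (fun _ => 1)
  simp only [mul_one] at this
  rw [this]
  simp_rw [fun u => pi2_one (L1 := L1) (L2 := L2) (h11 u) (h21 u)]
  simpa using hU1

open Classical in
lemma covering {U V1 V2 : Type} [Fintype U] [Fintype V1] [Fintype V2] {L0 L1 L2 : ℕ}
    (hL0 : 0 < L0) (hL1 : 0 < L1) (hL2 : 0 < L2)
    {pU : U → ℝ} {k1 : U → V1 → ℝ} {k2 : U → V2 → ℝ}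
    (hU : ∀ u, 0 ≤ pU u) (h1 : ∀ u v, 0 ≤ k1 u v) (h2 : ∀ u v, 0 ≤ k2 u v)
    (hU1 : ∑ u, pU u = 1) (h11 : ∀ u, ∑ v, k1 u v = 1) (h21 : ∀ u, ∑ v, k2 u v = 1)
    {q : U → V1 → V2 → ℝ} (hq : ∀ u v w, 0 ≤ q u v w) (hq1 : ∑ u, ∑ v, ∑ w, q u v w = 1)
    (A : U → V1 → V2 → Prop) {E0 E1 E2 E12 : ℝ} (hE0 : 0 ≤ E0) (hE1 : 0 ≤ E1) (hE2 : 0 ≤ E2)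
    (hE12 : 0 ≤ E12)
    (hA0 : ∀ u v w, A u v w → ∑ v', ∑ w', q u v' w' ≤ pU u * E0)
    (hA1 : ∀ u v w, A u v w → ∑ w', q u v w' ≤ pU u * k1 u v * E1)
    (hA2 : ∀ u v w, A u v w → ∑ v', q u v' w ≤ pU u * k2 u w * E2)
    (hA12 : ∀ u v w, A u v w → q u v w ≤ pU u * k1 u v * k2 u w * E12) :
    ∑ C : Fin L0 → U × (Fin L1 → V1) × (Fin L2 → V2), (∏ l, Q0 pU k1 k2 (C l)) *
      (if ∃ l i j, A (C l).1 ((C l).2.1 i) ((C l).2.2 j) then 0 else 1)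
    ≤ (1 - ∑ u, ∑ v, ∑ w, if A u v w then q u v w else 0)
      + (1 + E0 + E1 / L1 + E2 / L2 + E12 / (L1 * L2)) / L0 := by
  set W : U → V1 → V2 → ℝ := fun u v w =>
    if A u v w then q u v w / (pU u * k1 u v * k2 u w) else 0 with hWdef
  set qa : U → V1 → V2 → ℝ := fun u v w => if A u v w then q u v w else 0 with hqa
  have hqa0 : ∀ u v w, 0 ≤ qa u v w := by
    intro u v w; simp only [hqa]; split_ifs; exacts [hq _ _ _, le_rfl]
  have hqaq : ∀ u v w, qa u v w ≤ q u v w := by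
    intro u v w; simp only [hqa]; split_ifs; exacts [le_rfl, hq _ _ _]
  have hW0 : ∀ u v w, 0 ≤ W u v w := by
    intro u v w; simp only [hWdef]; split_ifs
    · exact div_nonneg (hq _ _ _) (mul_nonneg (mul_nonneg (hU _) (h1 _ _)) (h2 _ _))
    · exact le_rfl
  have hW : ∀ u v w, pU u * k1 u v * k2 u w * W u v w = qa u v w := by
    intro u v w
    simp only [hWdef, hqa]
    split_ifs with h
    · by_cases hz : pU u * k1 u v * k2 u w = 0
      · have := hA12 u v w h
        rw [hz, zero_mul] at this
        rw [hz, zero_mul]; exact le_antisymm (hq _ _ _) this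
      · rw [mul_div_assoc', mul_div_cancel_left₀ _ hz]
    · simp
  set m := ∑ u, ∑ v, ∑ w, qa u v w with hm
  have hm0 : 0 ≤ m := Finset.sum_nonneg fun u _ => Finset.sum_nonneg fun v _ =>
    Finset.sum_nonneg fun w _ => hqa0 u v w
  have hm1 : m ≤ 1 := by
    rw [← hq1]
    exact Finset.sum_le_sum fun u _ => Finset.sum_le_sum fun v _ =>
      Finset.sum_le_sum fun w _ => hqaq u v w
  have hL1' : (0 : ℝ) < L1 := by exact_mod_cast hL1
  have hL2' : (0 : ℝ) < L2 := by exact_mod_cast hL2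
  have hL0' : (0 : ℝ) < L0 := by exact_mod_cast hL0
  set mean : U × (Fin L1 → V1) × (Fin L2 → V2) → ℝ := fun b =>
    (∑ i, ∑ j, W b.1 (b.2.1 i) (b.2.2 j)) / (L1 * L2) with hmean
  have hQ1 := Q0_one (L1 := L1) (L2 := L2) hU1 h11 h21
  have key := iid2 hL0 (Q0_nonneg (L1 := L1) (L2 := L2) hU h1 h2) hQ1 (fun b => mean b - 1)
  have hEmean : ∑ b, Q0 pU k1 k2 b * mean b = m := by
    rw [Q0_sum]
    rw [hm]
    refine Finset.sum_congr rfl fun u _ => ?_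
    have : ∑ a : Fin L1 → V1, ∑ b : Fin L2 → V2,
      (∏ i, k1 u (a i)) * (∏ j, k2 u (b j)) * mean (u, a, b)
       = (∑ i : Fin L1, ∑ j : Fin L2, ∑ a : Fin L1 → V1, ∑ b : Fin L2 → V2,
        (∏ i, k1 u (a i)) * (∏ j, k2 u (b j)) * W u (a i) (b j)) / (L1 * L2) := by
      have e : ∀ (a : Fin L1 → V1) (b : Fin L2 → V2),
        (∏ i, k1 u (a i)) * (∏ j, k2 u (b j)) * mean (u, a, b) =
        ∑ i, ∑ j, (∏ i, k1 u (a i)) * (∏ j, k2 u (b j)) * W u (a i) (b j) / (L1 * L2) := by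
        intro a b
        simp only [hmean]
        rw [← mul_div_assoc, Finset.mul_sum, Finset.sum_div]
        simp_rw [Finset.mul_sum, Finset.sum_div]
      simp_rw [e]
      simp_rw [Finset.sum_div]
      calc _ = ∑ a : Fin L1 → V1, ∑ i : Fin L1, ∑ b : Fin L2 → V2, ∑ j : Fin L2,
           (∏ i, k1 u (a i)) * (∏ j, k2 u (b j)) * W u (a i) (b j) / (L1 * L2) :=
            Finset.sum_congr rfl fun a _ => Finset.sum_comm
        _ = ∑ i : Fin L1, ∑ a : Fin L1 → V1, ∑ b : Fin L2 → V2, ∑ j : Fin L2,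
           (∏ i, k1 u (a i)) * (∏ j, k2 u (b j)) * W u (a i) (b j) / (L1 * L2) :=
            Finset.sum_comm
        _ = ∑ i : Fin L1, ∑ a : Fin L1 → V1, ∑ j : Fin L2, ∑ b : Fin L2 → V2,
           (∏ i, k1 u (a i)) * (∏ j, k2 u (b j)) * W u (a i) (b j) / (L1 * L2) :=
            Finset.sum_congr rfl fun i _ => Finset.sum_congr rfl fun a _ => Finset.sum_comm
        _ = _ := Finset.sum_congr rfl fun i _ => Finset.sum_comm
    rw [this]
    simp_rw [pi2_marg (h11 u) (h21 u) (W u)]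
    simp only [Finset.sum_const, Finset.card_univ, Fintype.card_fin, nsmul_eq_mul]
    rw [← mul_assoc, mul_div_cancel_left₀ _ (by positivity)]
    simp_rw [Finset.mul_sum]
    refine Finset.sum_congr rfl fun v _ => Finset.sum_congr rfl fun w _ => ?_
    rw [← hW u v w]; ring
  have hE1' : ∑ b, Q0 pU k1 k2 b * (mean b - 1) = m - 1 := by
    simp_rw [mul_sub, mul_one]
    rw [Finset.sum_sub_distrib, hEmean, hQ1]
  have hsum : ∑ u, ∑ v, ∑ w, pU u * k1 u v * k2 u w * W u v w ≤ 1 := by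
    simp_rw [hW]; exact hm1
  have hEsq : ∑ b, Q0 pU k1 k2 b * mean b ^ 2 ≤ E0 + E1 / L1 + E2 / L2 + E12 / (L1 * L2) := by
    rw [Q0_sum]
    have b1 : ∀ u, pU u * ∑ a : Fin L1 → V1, ∑ b : Fin L2 → V2,
      (∏ i, k1 u (a i)) * (∏ j, k2 u (b j)) * mean (u, a, b) ^ 2 ≤
      pU u * ((∑ x, ∑ y, k1 u x * k2 u y * W u x y) ^ 2
        + (∑ y, k2 u y * (∑ x, k1 u x * W u x y) ^ 2) / L2
        + (∑ x, k1 u x * (∑ y, k2 u y * W u x y) ^ 2) / L1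
        + (∑ x, ∑ y, k1 u x * k2 u y * W u x y ^ 2) / (L1 * L2)) := fun u =>
      mul_le_mul_of_nonneg_left (iid2d hL1 hL2 (h1 u) (h11 u) (h2 u) (h21 u) (W u)) (hU u)
    refine le_trans (Finset.sum_le_sum fun u _ => b1 u) ?_
    -- four bounds
    set r : U → ℝ := fun u => ∑ v, ∑ w, qa u v w with hr
    have hrm : ∑ u, r u = m := rfl
    have c0 : ∀ u, pU u * (∑ x, ∑ y, k1 u x * k2 u y * W u x y) ^ 2 ≤ r u * E0 := by
      intro u
      set G := ∑ x, ∑ y, k1 u x * k2 u y * W u x y with hG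
      have hG0 : 0 ≤ G := Finset.sum_nonneg fun x _ => Finset.sum_nonneg fun y _ =>
        mul_nonneg (mul_nonneg (h1 _ _) (h2 _ _)) (hW0 _ _ _)
      have hpG : pU u * G = r u := by
        simp only [hG, hr, Finset.mul_sum, ← hW]
        refine Finset.sum_congr rfl fun v _ => Finset.sum_congr rfl fun w _ => ?_
        ring
      have hle : r u ≤ pU u * E0 := by
        by_cases hex : ∃ v w, A u v w
        · obtain ⟨v, w, h⟩ := hex
          refine le_trans ?_ (hA0 u v w h)
          exact Finset.sum_le_sum fun v _ => Finset.sum_le_sum fun w _ => hqaq u v w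
        · push Not at hex
          have : r u = 0 := by simp [hr, hqa, hex]
          rw [this]; exact mul_nonneg (hU _) hE0
      calc pU u * G ^ 2 = G * r u := by rw [← hpG]; ring
        _ ≤ G * (pU u * E0) := by gcongr
        _ = r u * E0 := by rw [← hpG]; ring
    have c1 : ∀ u, pU u * (∑ x, k1 u x * (∑ y, k2 u y * W u x y) ^ 2) ≤ r u * E1 := by
      intro u
      rw [Finset.mul_sum, hr, Finset.sum_mul]
      refine Finset.sum_le_sum fun v _ => ?_
      set G := ∑ y, k2 u y * W u v y with hG
      have hG0 : 0 ≤ G := Finset.sum_nonneg fun y _ => mul_nonneg (h2 _ _) (hW0 _ _ _)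
      have hpG : pU u * k1 u v * G = ∑ w, qa u v w := by
        simp only [hG, Finset.mul_sum, ← hW]
        refine Finset.sum_congr rfl fun w _ => ?_
        ring
      have hle : ∑ w, qa u v w ≤ pU u * k1 u v * E1 := by
        by_cases hex : ∃ w, A u v w
        · obtain ⟨w, h⟩ := hex
          refine le_trans ?_ (hA1 u v w h)
          exact Finset.sum_le_sum fun w _ => hqaq u v w
        · push Not at hex
          have : ∑ w, qa u v w = 0 := by simp [hqa, hex]
          rw [this]; exact mul_nonneg (mul_nonneg (hU _) (h1 _ _)) hE1
      calc pU u * (k1 u v * G ^ 2) = G * ∑ w, qa u v w := by rw [← hpG]; ring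
        _ ≤ G * (pU u * k1 u v * E1) := by gcongr
        _ = _ := by rw [← hpG]; ring
    have c2 : ∀ u, pU u * (∑ y, k2 u y * (∑ x, k1 u x * W u x y) ^ 2) ≤ r u * E2 := by
      intro u
      have : r u = ∑ w, ∑ v, qa u v w := by simp only [hr]; rw [Finset.sum_comm]
      rw [Finset.mul_sum, this, Finset.sum_mul]
      refine Finset.sum_le_sum fun w _ => ?_
      set G := ∑ x, k1 u x * W u x w with hG
      have hG0 : 0 ≤ G := Finset.sum_nonneg fun y _ => mul_nonneg (h1 _ _) (hW0 _ _ _)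
      have hpG : pU u * k2 u w * G = ∑ v, qa u v w := by
        simp only [hG, Finset.mul_sum, ← hW]
        refine Finset.sum_congr rfl fun w _ => ?_
        ring
      have hle : ∑ v, qa u v w ≤ pU u * k2 u w * E2 := by
        by_cases hex : ∃ v, A u v w
        · obtain ⟨v, h⟩ := hex
          refine le_trans ?_ (hA2 u v w h)
          exact Finset.sum_le_sum fun v _ => hqaq u v w
        · push Not at hex
          have : ∑ v, qa u v w = 0 := by simp [hqa, hex]
          rw [this]; exact mul_nonneg (mul_nonneg (hU _) (h2 _ _)) hE2
      calc pU u * (k2 u w * G ^ 2) = G * ∑ v, qa u v w := by rw [← hpG]; ring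
        _ ≤ G * (pU u * k2 u w * E2) := by gcongr
        _ = _ := by rw [← hpG]; ring
    have c12 : ∀ u, pU u * (∑ x, ∑ y, k1 u x * k2 u y * W u x y ^ 2) ≤ r u * E12 := by
      intro u
      rw [Finset.mul_sum, hr, Finset.sum_mul]
      refine Finset.sum_le_sum fun v _ => ?_
      rw [Finset.mul_sum, Finset.sum_mul]
      refine Finset.sum_le_sum fun w _ => ?_
      have hle : qa u v w ≤ pU u * k1 u v * k2 u w * E12 := by
        by_cases hex : A u v w
        · exact le_trans (hqaq u v w) (hA12 u v w hex)
        · have : qa u v w = 0 := by simp [hqa, hex]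
          rw [this]; exact mul_nonneg (mul_nonneg (mul_nonneg (hU _) (h1 _ _)) (h2 _ _)) hE12
      have hW0' := hW0 u v w
      calc pU u * (k1 u v * k2 u w * W u v w ^ 2) = W u v w * qa u v w := by rw [← hW]; ring
        _ ≤ W u v w * (pU u * k1 u v * k2 u w * E12) := by gcongr
        _ = _ := by rw [← hW]; ring
    calc _ ≤ ∑ u, (r u * E0 + r u * E2 / L2 + r u * E1 / L1 + r u * E12 / (L1 * L2)) := by
          refine Finset.sum_le_sum fun u _ => ?_
          rw [mul_add, mul_add, mul_add, ← mul_div_assoc, ← mul_div_assoc, ← mul_div_assoc]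
          have := c0 u
          have := c1 u
          have := c2 u
          have := c12 u
          gcongr
      _ = m * (E0 + E1 / L1 + E2 / L2 + E12 / (L1 * L2)) := by
          rw [← hrm, Finset.sum_mul]
          refine Finset.sum_congr rfl fun u _ => ?_
          ring
      _ ≤ 1 * (E0 + E1 / L1 + E2 / L2 + E12 / (L1 * L2)) := by gcongr
      _ = _ := one_mul _
  have hEsq' : ∑ b, Q0 pU k1 k2 b * (mean b - 1) ^ 2
      ≤ 1 + E0 + E1 / L1 + E2 / L2 + E12 / (L1 * L2) := by
    have : ∀ b, Q0 pU k1 k2 b * (mean b - 1) ^ 2 = Q0 pU k1 k2 b * mean b ^ 2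
        - 2 * (Q0 pU k1 k2 b * mean b) + Q0 pU k1 k2 b := by intro b; ring
    simp_rw [this]
    rw [Finset.sum_add_distrib, Finset.sum_sub_distrib, ← Finset.mul_sum, hEmean, hQ1]
    linarith
  rw [hE1'] at key
  calc _ ≤ ∑ C : Fin L0 → U × (Fin L1 → V1) × (Fin L2 → V2), (∏ l, Q0 pU k1 k2 (C l)) *
        ((∑ l, (mean (C l) - 1)) / L0) ^ 2 := by
        refine Finset.sum_le_sum fun C _ => mul_le_mul_of_nonneg_left ?_
          (pi_nonneg (Q0_nonneg hU h1 h2) C)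
        split_ifs with h
        · positivity
        · push Not at h
          have : ∀ l, mean (C l) = 0 := by
            intro l; simp [hmean, hWdef, h]
          simp [this, hL0'.ne']
    _ ≤ _ := key
    _ ≤ _ := by
        have : (m - 1) ^ 2 ≤ 1 - m := by nlinarith
        gcongr

open Classical in
lemma packing {U V1 V2 : Type} [Fintype U] [Fintype V1] [Fintype V2] {L0 L1 L2 : ℕ}
    {pU : U → ℝ} {k1 : U → V1 → ℝ} {k2 : U → V2 → ℝ}
    (hU : ∀ u, 0 ≤ pU u) (h1 : ∀ u v, 0 ≤ k1 u v) (h2 : ∀ u v, 0 ≤ k2 u v)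
    (hU1 : ∑ u, pU u = 1) (h11 : ∀ u, ∑ v, k1 u v = 1) (h21 : ∀ u, ∑ v, k2 u v = 1)
    (T1 : U → V1 → Prop) (T2 : U → V2 → Prop) {t1 t2 : ℝ}
    (ht1 : ∑ u, ∑ v, pU u * k1 u v * (if T1 u v then 1 else 0) ≤ t1)
    (ht2 : ∑ u, ∑ v, pU u * k2 u v * (if T2 u v then 1 else 0) ≤ t2) :
    ∑ C : Fin L0 → U × (Fin L1 → V1) × (Fin L2 → V2), (∏ l, Q0 pU k1 k2 (C l)) *
      (if ∃ l, (∃ i, T1 (C l).1 ((C l).2.1 i)) ∨ (∃ j, T2 (C l).1 ((C l).2.2 j)) then 1 else 0)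
    ≤ L0 * (L1 * t1 + L2 * t2) := by
  set f : U × (Fin L1 → V1) × (Fin L2 → V2) → ℝ := fun b =>
    ∑ i, (if T1 b.1 (b.2.1 i) then 1 else 0) + ∑ j, (if T2 b.1 (b.2.2 j) then 1 else 0) with hf
  have hf0 : ∀ b, 0 ≤ f b := fun b => by
    simp only [hf]
    refine add_nonneg (Finset.sum_nonneg fun i _ => ?_) (Finset.sum_nonneg fun i _ => ?_) <;>
    split_ifs <;> norm_num
  have hQ1 := Q0_one (L1 := L1) (L2 := L2) hU1 h11 h21
  have hEf : ∑ b, Q0 pU k1 k2 b * f b ≤ L1 * t1 + L2 * t2 := by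
    have hs : ∀ b, Q0 pU k1 k2 b * f b =
        ∑ i, Q0 pU k1 k2 b * (if T1 b.1 (b.2.1 i) then 1 else 0)
        + ∑ j, Q0 pU k1 k2 b * (if T2 b.1 (b.2.2 j) then 1 else 0) := by
      intro b; simp only [hf]; rw [mul_add, Finset.mul_sum, Finset.mul_sum]
    simp_rw [hs]
    rw [Finset.sum_add_distrib]
    have e1 : ∀ i : Fin L1, ∑ b : U × (Fin L1 → V1) × (Fin L2 → V2),
        Q0 pU k1 k2 b * (if T1 b.1 (b.2.1 i) then 1 else 0) ≤ t1 := by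
      intro i
      refine le_trans (le_of_eq ?_) ht1
      rw [Q0_sum (fun b => (if T1 b.1 (b.2.1 i) then 1 else 0))]
      refine Finset.sum_congr rfl fun u _ => ?_
      simp_rw [mul_assoc (pU u), ← Finset.mul_sum]
      congr 1
      rw [← pi_marg (h11 u) (fun v => if T1 u v then 1 else 0) i]
      refine Finset.sum_congr rfl fun a _ => ?_
      by_cases hT : T1 u (a i)
      · simp only [hT, if_true, mul_one]; rw [← Finset.mul_sum, pi_sum_one (h21 u), mul_one]
      · simp [hT]
    have e2 : ∀ j : Fin L2, ∑ b : U × (Fin L1 → V1) × (Fin L2 → V2),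
        Q0 pU k1 k2 b * (if T2 b.1 (b.2.2 j) then 1 else 0) ≤ t2 := by
      intro i
      refine le_trans (le_of_eq ?_) ht2
      rw [Q0_sum (fun b => (if T2 b.1 (b.2.2 i) then 1 else 0))]
      refine Finset.sum_congr rfl fun u _ => ?_
      simp_rw [mul_assoc (pU u), ← Finset.mul_sum]
      congr 1
      rw [← pi_marg (h21 u) (fun v => if T2 u v then 1 else 0) i, Finset.sum_comm]
      refine Finset.sum_congr rfl fun a _ => ?_
      by_cases hT : T2 u (a i)
      · simp only [hT, if_true, mul_one]; rw [← Finset.sum_mul, pi_sum_one (h11 u), one_mul]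
      · simp [hT]
    refine add_le_add ?_ ?_
    · rw [Finset.sum_comm]
      refine le_trans (Finset.sum_le_sum fun i _ => e1 i) ?_
      simp
    · rw [Finset.sum_comm]
      refine le_trans (Finset.sum_le_sum fun i _ => e2 i) ?_
      simp
  calc _ ≤ ∑ C : Fin L0 → U × (Fin L1 → V1) × (Fin L2 → V2), (∏ l, Q0 pU k1 k2 (C l)) *
        ∑ l, f (C l) := by
        refine Finset.sum_le_sum fun C _ => mul_le_mul_of_nonneg_left ?_
          (pi_nonneg (Q0_nonneg hU h1 h2) C)
        split_ifs with h
        · obtain ⟨l, h⟩ := h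
          refine le_trans ?_ (Finset.single_le_sum (f := fun l => f (C l)) (fun l _ => hf0 (C l))
            (Finset.mem_univ l))
          simp only [hf]
          rcases h with ⟨i, hi⟩ | ⟨j, hj⟩
          · have a1 : (1 : ℝ) ≤ ∑ i, (if T1 (C l).1 ((C l).2.1 i) then (1 : ℝ) else 0) := by
              refine le_trans ?_ (Finset.single_le_sum
                (f := fun i => if T1 (C l).1 ((C l).2.1 i) then (1 : ℝ) else 0)
                (fun l _ => by split_ifs <;> norm_num) (Finset.mem_univ i))
              simp [hi]
            have a2 : (0 : ℝ) ≤ ∑ j, (if T2 (C l).1 ((C l).2.2 j) then (1 : ℝ) else 0) :=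
              Finset.sum_nonneg fun j _ => by split_ifs <;> norm_num
            linarith
          · have a1 : (1 : ℝ) ≤ ∑ i, (if T2 (C l).1 ((C l).2.2 i) then (1 : ℝ) else 0) := by
              refine le_trans ?_ (Finset.single_le_sum
                (f := fun i => if T2 (C l).1 ((C l).2.2 i) then (1 : ℝ) else 0)
                (fun l _ => by split_ifs <;> norm_num) (Finset.mem_univ j))
              simp [hj]
            have a2 : (0 : ℝ) ≤ ∑ j, (if T1 (C l).1 ((C l).2.1 j) then (1 : ℝ) else 0) :=
              Finset.sum_nonneg fun j _ => by split_ifs <;> norm_num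
            linarith
        · exact Finset.sum_nonneg fun l _ => hf0 _
    _ = ∑ l : Fin L0, ∑ b, Q0 pU k1 k2 b * f b := by
        simp_rw [Finset.mul_sum]
        rw [Finset.sum_comm]
        refine Finset.sum_congr rfl fun l _ => ?_
        rw [pi_marg hQ1 f l]
    _ ≤ _ := by
        simp only [Finset.sum_const, Finset.card_univ, Fintype.card_fin, nsmul_eq_mul]
        gcongr

/-- Some point is at most the average. -/
lemma exists_le_avg {A : Type} [Fintype A] {μ : A → ℝ} (h0 : ∀ a, 0 ≤ μ a) (h1 : ∑ a, μ a = 1)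
    (f : A → ℝ) {t : ℝ} (h : ∑ a, μ a * f a ≤ t) : ∃ a, f a ≤ t := by
  by_contra hcon
  push Not at hcon
  have hpos : ∃ a, 0 < μ a := by
    by_contra h2
    push Not at h2
    have : ∑ a, μ a ≤ 0 := Finset.sum_nonpos fun a _ => h2 a
    linarith
  obtain ⟨a, ha⟩ := hpos
  have : ∑ a, μ a * t < ∑ a, μ a * f a :=
    Finset.sum_lt_sum (fun b _ => mul_le_mul_of_nonneg_left (hcon b).le (h0 b))
      ⟨a, Finset.mem_univ _, mul_lt_mul_of_pos_left (hcon a) ha⟩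
  rw [← Finset.sum_mul, h1, one_mul] at this
  linarith

lemma greedy {A : Type} [Fintype A] {μ : A → ℝ} (h0 : ∀ a, 0 ≤ μ a) (h1 : ∑ a, μ a = 1)
    (e : A → ℝ) (K : A → A → ℝ) {η q : ℝ} (hq : 0 ≤ q) (he : ∑ a, μ a * e a ≤ η)
    (hK : ∀ a, ∑ b, μ b * K a b ≤ q) (N : ℕ) :
    ∃ c : ℕ → A, ∑ i ∈ Finset.range N, e (c i) +
      ∑ j ∈ Finset.range N, ∑ i ∈ Finset.range j, K (c i) (c j) ≤ N * η + N * N * q := by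
  classical
  induction N with
  | zero =>
    obtain ⟨a, -⟩ := exists_le_avg h0 h1 e he
    exact ⟨fun _ => a, by simp⟩
  | succ N ih =>
    obtain ⟨c, hc⟩ := ih
    obtain ⟨a, ha⟩ := exists_le_avg h0 h1 (fun b => e b + ∑ i ∈ Finset.range N, K (c i) b)
      (t := η + N * q) (by
        simp_rw [mul_add]
        rw [Finset.sum_add_distrib]
        refine add_le_add he ?_
        simp_rw [Finset.mul_sum]
        rw [Finset.sum_comm]
        refine le_trans (Finset.sum_le_sum fun i _ => hK (c i)) ?_
        simp)
    refine ⟨Function.update c N a, ?_⟩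
    have hlt : ∀ i ∈ Finset.range N, Function.update c N a i = c i := by
      intro i hi
      rw [Function.update_of_ne (Finset.mem_range.1 hi).ne]
    rw [Finset.sum_range_succ, Finset.sum_range_succ]
    have s1 : ∑ i ∈ Finset.range N, e (Function.update c N a i) = ∑ i ∈ Finset.range N, e (c i) :=
      Finset.sum_congr rfl fun i hi => by rw [hlt i hi]
    have s2 : ∑ j ∈ Finset.range N, ∑ i ∈ Finset.range j,
        K (Function.update c N a i) (Function.update c N a j) =
        ∑ j ∈ Finset.range N, ∑ i ∈ Finset.range j, K (c i) (c j) :=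
      Finset.sum_congr rfl fun j hj => Finset.sum_congr rfl fun i hi => by
        rw [hlt j hj, hlt i (Finset.mem_range.2 ((Finset.mem_range.1 hi).trans
          (Finset.mem_range.1 hj)))]
    have s3 : ∑ i ∈ Finset.range N, K (Function.update c N a i) (Function.update c N a N)
        = ∑ i ∈ Finset.range N, K (c i) a :=
      Finset.sum_congr rfl fun i hi => by rw [hlt i hi, Function.update_self]
    rw [s1, s2, s3, Function.update_self]
    push_cast
    nlinarith

lemma expurgate (N : ℕ) (t : ℕ → ℝ) (ht : ∀ i, 0 ≤ t i) {τ : ℝ} (hτ : 0 < τ)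
    (h : ∑ i ∈ Finset.range N, t i ≤ N * τ) :
    N ≤ 2 * ((Finset.range N).filter (fun i => t i ≤ 2 * τ)).card := by
  have hc := Finset.card_filter_add_card_filter_not (s := Finset.range N) (fun i => t i ≤ 2 * τ)
  rw [Finset.card_range] at hc
  have h2 : (((Finset.range N).filter (fun i => ¬ t i ≤ 2 * τ)).card : ℝ) * (2 * τ)
      ≤ N * τ := by
    refine le_trans ?_ h
    refine le_trans ?_ (Finset.sum_le_sum_of_subset_of_nonneg
      (Finset.filter_subset (fun i => ¬ t i ≤ 2 * τ) _) (fun i _ _ => ht i))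
    rw [← nsmul_eq_mul]
    refine Finset.card_nsmul_le_sum _ _ _ fun i hi => ?_
    have := (Finset.mem_filter.1 hi).2
    linarith
  have h3 : 2 * (((Finset.range N).filter (fun i => ¬ t i ≤ 2 * τ)).card : ℝ) ≤ N := by
    by_contra hcon
    rw [not_le] at hcon
    nlinarith
  have h4 : 2 * ((Finset.range N).filter (fun i => ¬ t i ≤ 2 * τ)).card ≤ N := by
    exact_mod_cast h3
  omega

open Classical in
lemma oneshot {S U V1 V2 X Y : Type} [Fintype S] [Fintype U] [Fintype V1] [Fintype V2]
    [Fintype Y] [Nonempty X] {L0 L1 L2 : ℕ}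
    (hL0 : 0 < L0) (hL1 : 0 < L1) (hL2 : 0 < L2)
    {pS : S → ℝ} (hS : ∀ s, 0 ≤ pS s) (hS1 : ∑ s, pS s = 1)
    {W1 W2 : X → S → Y → ℝ} (hW10 : ∀ x s y, 0 ≤ W1 x s y) (hW20 : ∀ x s y, 0 ≤ W2 x s y)
    (hW11 : ∀ x s, ∑ y, W1 x s y = 1) (hW21 : ∀ x s, ∑ y, W2 x s y = 1)
    {pU : U → ℝ} {k1 : U → V1 → ℝ} {k2 : U → V2 → ℝ}
    (hU : ∀ u, 0 ≤ pU u) (h1 : ∀ u v, 0 ≤ k1 u v) (h2 : ∀ u v, 0 ≤ k2 u v)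
    (hU1 : ∑ u, pU u = 1) (h11 : ∀ u, ∑ v, k1 u v = 1) (h21 : ∀ u, ∑ v, k2 u v = 1)
    {q : S → U → V1 → V2 → ℝ} (hq : ∀ s u v w, 0 ≤ q s u v w)
    (hq1 : ∀ s, ∑ u, ∑ v, ∑ w, q s u v w = 1)
    (A : S → U → V1 → V2 → Prop) {E0 E1 E2 E12 : ℝ} (hE0 : 0 ≤ E0) (hE1 : 0 ≤ E1) (hE2 : 0 ≤ E2)
    (hE12 : 0 ≤ E12)
    (hA0 : ∀ s u v w, A s u v w → ∑ v', ∑ w', q s u v' w' ≤ pU u * E0)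
    (hA1 : ∀ s u v w, A s u v w → ∑ w', q s u v w' ≤ pU u * k1 u v * E1)
    (hA2 : ∀ s u v w, A s u v w → ∑ v', q s u v' w ≤ pU u * k2 u w * E2)
    (hA12 : ∀ s u v w, A s u v w → q s u v w ≤ pU u * k1 u v * k2 u w * E12)
    (T1 : U → V1 → Y → Prop) (T2 : U → V2 → Y → Prop) {t1 t2 : ℝ}
    (ht10 : 0 ≤ t1) (ht20 : 0 ≤ t2)
    (ht1 : ∀ y, ∑ u, ∑ v, pU u * k1 u v * (if T1 u v y then 1 else 0) ≤ t1)
    (ht2 : ∀ y, ∑ u, ∑ v, pU u * k2 u v * (if T2 u v y then 1 else 0) ≤ t2)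
    {η δ : ℝ} (hη : 0 ≤ η)
    (hAx : ∀ s u v w, A s u v w → ∃ x, ∑ y, W1 x s y * (if T1 u v y then 0 else 1)
      + ∑ y, W2 x s y * (if T2 u w y then 0 else 1) ≤ η)
    (hPA : ∑ s, pS s * (1 - ∑ u, ∑ v, ∑ w, if A s u v w then q s u v w else 0) ≤ δ)
    {N : ℕ} {τ : ℝ} (hτ : 0 < τ)
    (hτ' : η + 2 * (δ + (1 + E0 + E1 / L1 + E2 / L2 + E12 / (L1 * L2)) / L0)
      + N * (2 * (L0 * (L1 * t1 + L2 * t2))) ≤ τ) (hN : 0 < N) :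
    ∃ M : ℕ, N ≤ 2 * M ∧ ∃ (φ : Fin M → S → X) (ψ : Y → Fin M), ∀ m,
      (∑ s, pS s * ∑ y, W1 (φ m s) s y * (if ψ y ≠ m then 1 else 0)) ≤ 2 * τ ∧
      (∑ s, pS s * ∑ y, W2 (φ m s) s y * (if ψ y ≠ m then 1 else 0)) ≤ 2 * τ := by
  set D : (Fin L0 → U × (Fin L1 → V1) × (Fin L2 → V2)) → Y → Prop := fun C y =>
    ∃ l, (∃ i, T1 (C l).1 ((C l).2.1 i) y) ∨ (∃ j, T2 (C l).1 ((C l).2.2 j) y) with hD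
  set Q : (Fin L0 → U × (Fin L1 → V1) × (Fin L2 → V2)) → ℝ := fun C =>
    ∏ l, Q0 pU k1 k2 (C l) with hQ
  have hQ0 : ∀ C, 0 ≤ Q C := fun C => pi_nonneg (Q0_nonneg hU h1 h2) C
  have hQ1 : ∑ C, Q C = 1 := pi_sum_one (Q0_one hU1 h11 h21)
  set Wb : X → S → Y → ℝ := fun x s y => W1 x s y + W2 x s y with hWb
  have hWb0 : ∀ x s y, 0 ≤ Wb x s y := fun x s y => add_nonneg (hW10 _ _ _) (hW20 _ _ _)
  have hWb1 : ∀ x s, ∑ y, Wb x s y = 2 := fun x s => by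
    simp only [hWb]; rw [Finset.sum_add_distrib, hW11, hW21]; norm_num
  have henc : ∀ C s, ∃ x, (∃ l i j, A s (C l).1 ((C l).2.1 i) ((C l).2.2 j)) →
      ∑ y, Wb x s y * (if D C y then 0 else 1) ≤ η := by
    intro C s
    by_cases h : ∃ l i j, A s (C l).1 ((C l).2.1 i) ((C l).2.2 j)
    · obtain ⟨l, i, j, hh⟩ := h
      obtain ⟨x, hx⟩ := hAx _ _ _ _ hh
      refine ⟨x, fun _ => le_trans ?_ hx⟩
      rw [← Finset.sum_add_distrib]
      refine Finset.sum_le_sum fun y _ => ?_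
      simp only [hWb, add_mul]
      refine add_le_add (mul_le_mul_of_nonneg_left ?_ (hW10 _ _ _))
        (mul_le_mul_of_nonneg_left ?_ (hW20 _ _ _))
      · by_cases hT : T1 (C l).1 ((C l).2.1 i) y
        · have : D C y := ⟨l, Or.inl ⟨i, hT⟩⟩
          simp [this, hT]
        · simp only [hT, if_false]; split_ifs <;> norm_num
      · by_cases hT : T2 (C l).1 ((C l).2.2 j) y
        · have : D C y := ⟨l, Or.inr ⟨j, hT⟩⟩
          simp [this, hT]
        · simp only [hT, if_false]; split_ifs <;> norm_num
    · exact ⟨Classical.arbitrary X, fun h' => absurd h' h⟩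
  choose enc henc using henc
  set e : (Fin L0 → U × (Fin L1 → V1) × (Fin L2 → V2)) → ℝ := fun C =>
    ∑ s, pS s * ∑ y, Wb (enc C s) s y * (if D C y then 0 else 1) with he
  set K : (Fin L0 → U × (Fin L1 → V1) × (Fin L2 → V2)) →
      (Fin L0 → U × (Fin L1 → V1) × (Fin L2 → V2)) → ℝ := fun C C' =>
    ∑ s, pS s * ∑ y, Wb (enc C s) s y * (if D C' y then 1 else 0) with hK
  have ite01 : ∀ (p : Prop) [Decidable p], (0 : ℝ) ≤ if p then 0 else 1 := fun p _ => by split_ifs <;> norm_num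
  have ite10 : ∀ (p : Prop) [Decidable p], (0 : ℝ) ≤ if p then 1 else 0 := fun p _ => by split_ifs <;> norm_num
  have he0 : ∀ C, 0 ≤ e C := fun C => Finset.sum_nonneg fun s _ => mul_nonneg (hS s)
    (Finset.sum_nonneg fun y _ => mul_nonneg (hWb0 _ _ _) (ite01 _))
  have hK0 : ∀ C C', 0 ≤ K C C' := fun C C' => Finset.sum_nonneg fun s _ => mul_nonneg (hS s)
    (Finset.sum_nonneg fun y _ => mul_nonneg (hWb0 _ _ _) (ite10 _))
  have heE : ∑ C, Q C * e C ≤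
      η + 2 * (δ + (1 + E0 + E1 / L1 + E2 / L2 + E12 / (L1 * L2)) / L0) := by
    have e1 : ∀ C, e C ≤ η + 2 * ∑ s, pS s *
        (if ∃ l i j, A s (C l).1 ((C l).2.1 i) ((C l).2.2 j) then 0 else 1) := by
      intro C
      have : η = ∑ s, pS s * η := by rw [← Finset.sum_mul, hS1, one_mul]
      rw [this, Finset.mul_sum, ← Finset.sum_add_distrib]
      refine Finset.sum_le_sum fun s _ => ?_
      have hcore : ∑ y, Wb (enc C s) s y * (if D C y then 0 else 1) ≤ η + 2 *
        (if ∃ l i j, A s (C l).1 ((C l).2.1 i) ((C l).2.2 j) then 0 else 1) := by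
        split_ifs with h
        · simpa using henc C s h
        · calc _ ≤ ∑ y, Wb (enc C s) s y := by
                refine Finset.sum_le_sum fun y _ => ?_
                have := hWb0 (enc C s) s y
                split_ifs <;> simp [this]
            _ ≤ _ := by rw [hWb1]; linarith
      calc _ ≤ pS s * (η + 2 *
        (if ∃ l i j, A s (C l).1 ((C l).2.1 i) ((C l).2.2 j) then 0 else 1)) :=
            mul_le_mul_of_nonneg_left hcore (hS s)
        _ = _ := by ring
    calc ∑ C, Q C * e C ≤ ∑ C, Q C * (η + 2 * ∑ s, pS s *
        (if ∃ l i j, A s (C l).1 ((C l).2.1 i) ((C l).2.2 j) then 0 else 1)) :=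
          Finset.sum_le_sum fun C _ => mul_le_mul_of_nonneg_left (e1 C) (hQ0 C)
      _ = η + 2 * ∑ s, pS s * ∑ C, Q C *
        (if ∃ l i j, A s (C l).1 ((C l).2.1 i) ((C l).2.2 j) then 0 else 1) := by
          simp_rw [mul_add]
          rw [Finset.sum_add_distrib, ← Finset.sum_mul, hQ1, one_mul]
          congr 1
          simp_rw [Finset.mul_sum]
          rw [Finset.sum_comm]
          refine Finset.sum_congr rfl fun s _ => Finset.sum_congr rfl fun C _ => ?_
          ring
      _ ≤ η + 2 * ∑ s, pS s * ((1 - ∑ u, ∑ v, ∑ w, if A s u v w then q s u v w else 0)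
          + (1 + E0 + E1 / L1 + E2 / L2 + E12 / (L1 * L2)) / L0) := by
          gcongr with s hs
          · exact hS s
          · exact covering hL0 hL1 hL2 hU h1 h2 hU1 h11 h21 (hq s) (hq1 s) (A s) hE0 hE1 hE2 hE12
              (hA0 s) (hA1 s) (hA2 s) (hA12 s)
      _ ≤ _ := by
          simp_rw [mul_add (pS _)]
          rw [Finset.sum_add_distrib, ← Finset.sum_mul, hS1, one_mul]
          gcongr
  have hKE : ∀ C, ∑ C', Q C' * K C C' ≤ 2 * (L0 * (L1 * t1 + L2 * t2)) := by
    intro C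
    calc _ = ∑ s, pS s * ∑ y, Wb (enc C s) s y * ∑ C', Q C' * (if D C' y then 1 else 0) := by
          simp only [hK, Finset.mul_sum]
          rw [Finset.sum_comm]
          refine Finset.sum_congr rfl fun s _ => ?_
          rw [Finset.sum_comm]
          refine Finset.sum_congr rfl fun y _ => Finset.sum_congr rfl fun C' _ => ?_
          ring
      _ ≤ ∑ s, pS s * ∑ y, Wb (enc C s) s y * (L0 * (L1 * t1 + L2 * t2)) := by
          gcongr with s hs y hy
          · exact hS s
          · exact hWb0 _ _ _
          · exact packing hU h1 h2 hU1 h11 h21 (fun u v => T1 u v y) (fun u v => T2 u v y)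
              (ht1 y) (ht2 y)
      _ = _ := by
          simp_rw [← Finset.sum_mul, hWb1]
          rw [← Finset.sum_mul, hS1, one_mul]
  have hqnn : 0 ≤ 2 * ((L0 : ℝ) * (L1 * t1 + L2 * t2)) := by positivity
  obtain ⟨c, hc⟩ := greedy hQ0 hQ1 e K hqnn heE hKE N
  set t : ℕ → ℝ := fun i => e (c i) + ∑ j ∈ (Finset.range N).filter (fun j => i < j), K (c i) (c j)
    with ht
  have ht0 : ∀ i, 0 ≤ t i := fun i => add_nonneg (he0 _) (Finset.sum_nonneg fun j _ => hK0 _ _)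
  have htsum : ∑ i ∈ Finset.range N, t i ≤ N * τ := by
    have : ∑ i ∈ Finset.range N, t i = ∑ i ∈ Finset.range N, e (c i) +
      ∑ j ∈ Finset.range N, ∑ i ∈ Finset.range j, K (c i) (c j) := by
      simp only [ht]
      rw [Finset.sum_add_distrib]
      congr 1
      refine Finset.sum_comm' fun x y => ?_
      simp only [Finset.mem_range, Finset.mem_filter]
      constructor
      · rintro ⟨a, b, c⟩; exact ⟨c, b⟩
      · rintro ⟨a, b⟩; exact ⟨a.trans b, b, a⟩
    rw [this]
    refine le_trans hc ?_
    rw [mul_assoc, ← mul_add]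
    gcongr
  have hcard := expurgate N t ht0 hτ htsum
  set I := (Finset.range N).filter (fun i => t i ≤ 2 * τ) with hI
  set emb := I.orderEmbOfFin rfl with hemb
  have hembI : ∀ m, emb m ∈ I := fun m => Finset.orderEmbOfFin_mem I rfl m
  have hMpos : 0 < I.card := by omega
  have hψ : ∀ y, ∃ m : Fin I.card, ∀ m0, D (c (emb m0)) y →
      (∀ m', m0 < m' → ¬ D (c (emb m')) y) → m = m0 := by
    intro y
    by_cases h : ∃ m0, D (c (emb m0)) y ∧ ∀ m', m0 < m' → ¬ D (c (emb m')) y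
    · obtain ⟨m, hm1, hm2⟩ := h
      refine ⟨m, fun m0 h1 h2 => ?_⟩
      rcases lt_trichotomy m m0 with h | h | h
      · exact absurd h1 (hm2 _ h)
      · exact h
      · exact absurd hm1 (h2 _ h)
    · push Not at h
      refine ⟨⟨0, hMpos⟩, fun m0 h1 h2 => ?_⟩
      obtain ⟨m', h3, h4⟩ := h m0 h1
      exact absurd h4 (h2 _ h3)
  choose ψ hψ using hψ
  refine ⟨I.card, hcard, fun m s => enc (c (emb m)) s, ψ, ?_⟩
  have hind : ∀ m y, (if ψ y ≠ m then (1 : ℝ) else 0) ≤ (if D (c (emb m)) y then 0 else 1) +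
      ∑ j ∈ (Finset.range N).filter (fun j => emb m < j), (if D (c j) y then 1 else 0) := by
    intro m y
    have hnn : (0 : ℝ) ≤ ∑ j ∈ (Finset.range N).filter (fun j => emb m < j),
      (if D (c j) y then 1 else 0) := Finset.sum_nonneg fun j _ => ite10 _
    by_cases hDm : D (c (emb m)) y
    · by_cases hall : ∀ m', m < m' → ¬ D (c (emb m')) y
      · rw [hψ y m hDm hall]; simpa [hDm] using hnn
      · push Not at hall
        obtain ⟨m', hm', hD'⟩ := hall
        have : (1 : ℝ) ≤ ∑ j ∈ (Finset.range N).filter (fun j => emb m < j),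
            (if D (c j) y then 1 else 0) := by
          refine le_trans ?_ (Finset.single_le_sum
            (f := fun j => if D (c j) y then (1 : ℝ) else 0) (fun j _ => ite10 _)
            (a := emb m') ?_)
          · simp [hD']
          · have := hembI m'
            rw [Finset.mem_filter]
            exact ⟨(Finset.mem_filter.1 this).1, emb.lt_iff_lt.2 hm'⟩
        refine le_trans ?_ (add_le_add (ite01 _) this)
        split_ifs <;> norm_num
    · simp only [hDm, if_false]
      split_ifs <;> linarith
  have hfin : ∀ m, (∑ s, pS s * ∑ y, Wb (enc (c (emb m)) s) s y * (if ψ y ≠ m then 1 else 0))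
      ≤ 2 * τ := by
    intro m
    have htm : t (emb m) ≤ 2 * τ := (Finset.mem_filter.1 (hembI m)).2
    refine le_trans ?_ htm
    calc _ ≤ ∑ s, pS s * ∑ y, Wb (enc (c (emb m)) s) s y * ((if D (c (emb m)) y then 0 else 1) +
      ∑ j ∈ (Finset.range N).filter (fun j => emb m < j), (if D (c j) y then 1 else 0)) := by
          gcongr with s hs y hy
          · exact hS s
          · exact hWb0 _ _ _
          · exact hind m y
      _ = _ := by
          simp only [ht, he, hK]
          rw [Finset.sum_comm, ← Finset.sum_add_distrib]
          refine Finset.sum_congr rfl fun s _ => ?_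
          rw [← Finset.mul_sum, ← mul_add, Finset.sum_comm, ← Finset.sum_add_distrib]
          congr 1
          refine Finset.sum_congr rfl fun y _ => ?_
          rw [mul_add, Finset.mul_sum]
  intro m
  constructor
  · refine le_trans ?_ (hfin m)
    gcongr with s hs y hy
    · exact hS s
    · simp only [hWb]; linarith [hW20 (enc (c (emb m)) s) s y]
  · refine le_trans ?_ (hfin m)
    gcongr with s hs y hy
    · exact hS s
    · simp only [hWb]; linarith [hW10 (enc (c (emb m)) s) s y]

lemma cheb {Z : Type} [Fintype Z] {μ : Z → ℝ} (h0 : ∀ a, 0 ≤ μ a) (h1 : ∑ a, μ a = 1)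
    (f : Z → ℝ) {I : ℝ} (hI : ∑ z, μ z * f z = I) {n : ℕ} (hn : 0 < n) {δ : ℝ} (hδ : 0 < δ) :
    ∑ z : Fin n → Z, (∏ i, μ (z i)) * (if ∑ i, f (z i) ≤ n * (I + δ) then 0 else 1)
      ≤ (∑ z, μ z * (f z - I) ^ 2) / (n * δ ^ 2) := by
  have hn' : (0 : ℝ) < n := by exact_mod_cast hn
  have key := iid2 hn h0 h1 (fun z => (f z - I))
  have hz : ∑ a, μ a * (f a - I) = 0 := by
    simp_rw [mul_sub]; rw [Finset.sum_sub_distrib, hI, ← Finset.sum_mul, h1]; ring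
  rw [hz] at key
  have h2 : ∑ z : Fin n → Z, (∏ i, μ (z i)) * (if ∑ i, f (z i) ≤ n * (I + δ) then 0 else 1)
      ≤ (∑ c : Fin n → Z, (∏ i, μ (c i)) * ((∑ i, (f (c i) - I)) / n) ^ 2) / δ ^ 2 := by
    rw [Finset.sum_div]
    refine Finset.sum_le_sum fun z _ => ?_
    rw [mul_div_assoc]
    refine mul_le_mul_of_nonneg_left ?_ (pi_nonneg h0 z)
    split_ifs with h
    · positivity
    · rw [not_le] at h
      rw [le_div_iff₀ (by positivity), one_mul]
      have : δ ≤ (∑ i, (f (z i) - I)) / n := by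
        rw [le_div_iff₀ hn', Finset.sum_sub_distrib]
        simp only [Finset.sum_const, Finset.card_univ, Fintype.card_fin, nsmul_eq_mul]
        linarith
      gcongr
  refine h2.trans ?_
  calc _ ≤ (0 ^ 2 + (∑ a, μ a * (f a - I) ^ 2) / n) / δ ^ 2 := by gcongr
    _ = _ := by rw [← div_div]; ring

lemma blk2 {A B : Type} [Fintype A] [Fintype B] {n : ℕ} (G : (Fin n → A × B) → ℝ) :
    ∑ z : Fin n → A × B, G z = ∑ a : Fin n → A, ∑ b : Fin n → B, G (fun i => (a i, b i)) := by
  rw [← Fintype.sum_prod_type' (f := fun (a : Fin n → A) (b : Fin n → B) => G (fun i => (a i, b i)))]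
  exact Fintype.sum_equiv (Equiv.arrowProdEquivProdArrow (Fin n) (fun _ => A) (fun _ => B)) _ _ (fun z => rfl)

lemma prod_exp_bound {n : ℕ} {f g d : Fin n → ℝ} {c : ℝ} (hg : ∀ i, 0 ≤ g i)
    (h : ∀ i, f i = g i * Real.exp (d i)) (hc : ∑ i, d i ≤ c) :
    ∏ i, f i ≤ (∏ i, g i) * Real.exp c := by
  simp_rw [h]
  rw [Finset.prod_mul_distrib, ← Real.exp_sum]
  have : 0 ≤ ∏ i, g i := Finset.prod_nonneg fun i _ => hg i
  gcongr

lemma test_bound {U V Y : Type} [Fintype U] [Fintype V] {n : ℕ} {pU : U → ℝ} {k : U → V → ℝ}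
    (G : U → V → Y → Prop) (j c : U → V → Y → ℝ) (hc : ∀ u v y, 0 ≤ c u v y)
    (hc1 : ∀ y, ∑ u, ∑ v, c u v y ≤ 1)
    (hj : ∀ u v y, G u v y → c u v y = pU u * k u v * Real.exp (j u v y)) (g : ℝ) (y : Fin n → Y)
    (T : (Fin n → U) → (Fin n → V) → Prop) [∀ u v, Decidable (T u v)]
    (hT : ∀ u v, T u v → (∀ i, G (u i) (v i) (y i)) ∧ g ≤ ∑ i, j (u i) (v i) (y i)) :
    ∑ u : Fin n → U, ∑ v : Fin n → V, (∏ i, pU (u i)) * (∏ i, k (u i) (v i)) *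
      (if T u v then 1 else 0) ≤ Real.exp (-g) := by
  calc _ ≤ ∑ u : Fin n → U, ∑ v : Fin n → V, (∏ i, c (u i) (v i) (y i)) * Real.exp (-g) := by
        refine Finset.sum_le_sum fun u _ => Finset.sum_le_sum fun v _ => ?_
        have hnn : 0 ≤ (∏ i, c (u i) (v i) (y i)) := Finset.prod_nonneg fun i _ => hc _ _ _
        split_ifs with h
        · obtain ⟨h1, h2⟩ := hT u v h
          rw [mul_one, ← Finset.prod_mul_distrib]
          refine prod_exp_bound (d := fun i => - j (u i) (v i) (y i)) (fun i => hc _ _ _)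
            (fun i => ?_) ?_
          · rw [hj _ _ _ (h1 i), mul_assoc, ← Real.exp_add]; simp
          · rw [Finset.sum_neg_distrib]; linarith
        · rw [mul_zero]; positivity
    _ = (∏ i, ∑ u, ∑ v, c u v (y i)) * Real.exp (-g) := by
        simp_rw [← Finset.sum_mul]
        congr 1
        rw [← sum_pi_prod (fun i u => ∑ v, c u v (y i))]
        refine Finset.sum_congr rfl fun u _ => ?_
        rw [← sum_pi_prod (fun i v => c (u i) v (y i))]
    _ ≤ 1 * Real.exp (-g) := by
        gcongr
        exact Finset.prod_le_one (fun i _ => Finset.sum_nonneg fun u _ =>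
          Finset.sum_nonneg fun v _ => hc _ _ _) (fun i _ => hc1 _)
    _ = _ := one_mul _

lemma ker_sum {A B : Type} [Fintype B] {n : ℕ} {k : A → B → ℝ}
    (h : ∀ a, ∑ b, k a b = 1) (a : Fin n → A) : ∑ b : Fin n → B, ∏ i, k (a i) (b i) = 1 := by
  rw [sum_pi_prod (fun i b => k (a i) b)]; simp [h]

lemma failbound {Ω Y : Type} [Fintype Ω] [Fintype Y] {μ : Ω → ℝ} (h0 : ∀ a, 0 ≤ μ a)
    (h1 : ∑ a, μ a = 1) {W : Ω → Y → ℝ} (hW0 : ∀ ω y, 0 ≤ W ω y) (hW1 : ∀ ω, ∑ y, W ω y = 1)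
    (j : Ω → Y → ℝ) (G : Ω → Y → Prop) (hG : ∀ ω y, 0 < μ ω → 0 < W ω y → G ω y) {J : ℝ}
    (hJ : ∑ ω, ∑ y, μ ω * W ω y * j ω y = J) {n : ℕ} (hn : 0 < n) {δ : ℝ} (hδ : 0 < δ)
    (T : (Fin n → Ω) → (Fin n → Y) → Prop) [∀ ω y, Decidable (T ω y)]
    (hT : ∀ ω y, (∀ i, G (ω i) (y i)) → n * (J - δ) ≤ ∑ i, j (ω i) (y i) → T ω y) :
    ∑ ω : Fin n → Ω, (∏ i, μ (ω i)) * ∑ y : Fin n → Y, (∏ i, W (ω i) (y i)) *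
      (if T ω y then 0 else 1) ≤
      (∑ z : Ω × Y, μ z.1 * W z.1 z.2 * (- j z.1 z.2 - (- J)) ^ 2) / (n * δ ^ 2) := by
  have hm0 : ∀ z : Ω × Y, 0 ≤ μ z.1 * W z.1 z.2 := fun z => mul_nonneg (h0 _) (hW0 _ _)
  have hm1 : ∑ z : Ω × Y, μ z.1 * W z.1 z.2 = 1 := by
    rw [Fintype.sum_prod_type]
    simp_rw [← Finset.mul_sum, hW1, mul_one, h1]
  have := cheb hm0 hm1 (fun z => - j z.1 z.2) (I := -J) (by
    rw [Fintype.sum_prod_type]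
    simp_rw [mul_neg, Finset.sum_neg_distrib, hJ]) hn hδ
  refine le_trans ?_ this
  rw [blk2]
  refine Finset.sum_le_sum fun ω _ => ?_
  rw [Finset.mul_sum]
  refine Finset.sum_le_sum fun y _ => ?_
  rw [← mul_assoc, ← Finset.prod_mul_distrib]
  have hnn : 0 ≤ ∏ i, (μ (ω i) * W (ω i) (y i)) :=
    Finset.prod_nonneg fun i _ => mul_nonneg (h0 _) (hW0 _ _)
  by_cases hz : ∏ i, (μ (ω i) * W (ω i) (y i)) = 0
  · simp [hz]
  refine mul_le_mul_of_nonneg_left ?_ hnn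
  by_cases hs : ∑ i, - j (ω i) (y i) ≤ n * (-J + δ)
  · have hTT : T ω y := by
      refine hT ω y (fun i => ?_) ?_
      · rw [Finset.prod_eq_zero_iff] at hz
        push Not at hz
        have := hz i (Finset.mem_univ _)
        exact hG _ _ (lt_of_le_of_ne (h0 _) (fun h => this (by rw [← h, zero_mul])))
          (lt_of_le_of_ne (hW0 _ _) (fun h => this (by rw [← h, mul_zero])))
      · rw [Finset.sum_neg_distrib] at hs; linarith
    rw [if_pos hTT]; split_ifs <;> norm_num
  · simp only [hs, if_false]; split_ifs <;> norm_num

open Classical in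
lemma blockcode {S U V1 V2 X Y : Type} [Fintype S] [Fintype U] [Fintype V1] [Fintype V2]
    [Fintype X] [Fintype Y] [Nonempty X]
    {pS : S → ℝ} (hS : ∀ s, 0 ≤ pS s) (hS1 : ∑ s, pS s = 1)
    {W1 W2 : X → S → Y → ℝ} (hW10 : ∀ x s y, 0 ≤ W1 x s y) (hW20 : ∀ x s y, 0 ≤ W2 x s y)
    (hW11 : ∀ x s, ∑ y, W1 x s y = 1) (hW21 : ∀ x s, ∑ y, W2 x s y = 1)
    {pU : U → ℝ} {k1 : U → V1 → ℝ} {k2 : U → V2 → ℝ}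
    (hU : ∀ u, 0 ≤ pU u) (h1 : ∀ u v, 0 ≤ k1 u v) (h2 : ∀ u v, 0 ≤ k2 u v)
    (hU1 : ∑ u, pU u = 1) (h11 : ∀ u, ∑ v, k1 u v = 1) (h21 : ∀ u, ∑ v, k2 u v = 1)
    {r : S → U → V1 → V2 → X → ℝ} (hr : ∀ s u v w x, 0 ≤ r s u v w x)
    (hr1 : ∀ s, ∑ u, ∑ v, ∑ w, ∑ x, r s u v w x = 1)
    {q : S → U → V1 → V2 → ℝ} (hq : ∀ s u v w, q s u v w = ∑ x, r s u v w x)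
    {μ : S × U × V1 × V2 × X → ℝ}
    (hμ : ∀ z, μ z = pS z.1 * r z.1 z.2.1 z.2.2.1 z.2.2.2.1 z.2.2.2.2)
    (d0 : S → U → ℝ) (d1 : S → U → V1 → ℝ) (d2 : S → U → V2 → ℝ) (dc : S → U → V1 → V2 → ℝ)
    {I0 I1 I2 Ic J1 J2 : ℝ}
    (hI0 : ∑ z, μ z * d0 z.1 z.2.1 = I0) (hI1 : ∑ z, μ z * d1 z.1 z.2.1 z.2.2.1 = I1)
    (hI2 : ∑ z, μ z * d2 z.1 z.2.1 z.2.2.2.1 = I2)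
    (hIc : ∑ z, μ z * dc z.1 z.2.1 z.2.2.1 z.2.2.2.1 = Ic)
    (hd0 : ∀ s u v w x, 0 < pS s → 0 < r s u v w x →
      ∑ v, ∑ w, q s u v w = pU u * Real.exp (d0 s u))
    (hd1 : ∀ s u v w x, 0 < pS s → 0 < r s u v w x →
      ∑ w, q s u v w = pU u * k1 u v * Real.exp (d1 s u v))
    (hd2 : ∀ s u v w x, 0 < pS s → 0 < r s u v w x →
      ∑ v, q s u v w = pU u * k2 u w * Real.exp (d2 s u w))
    (hdc : ∀ s u v w x, 0 < pS s → 0 < r s u v w x →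
      q s u v w = pU u * k1 u v * k2 u w * Real.exp (d1 s u v + d2 s u w - d0 s u + dc s u v w))
    (G1 : U → V1 → Y → Prop) (j1 c1 : U → V1 → Y → ℝ) (hc1 : ∀ u v y, 0 ≤ c1 u v y)
    (hc11 : ∀ y, ∑ u, ∑ v, c1 u v y ≤ 1)
    (hj1 : ∀ u v y, G1 u v y → c1 u v y = pU u * k1 u v * Real.exp (j1 u v y))
    (hG1 : ∀ s u v w x y, 0 < pS s * r s u v w x → 0 < W1 x s y → G1 u v y)
    (hJ1 : ∑ z, ∑ y, μ z * W1 z.2.2.2.2 z.1 y * j1 z.2.1 z.2.2.1 y = J1)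
    (G2 : U → V2 → Y → Prop) (j2 c2 : U → V2 → Y → ℝ) (hc2 : ∀ u v y, 0 ≤ c2 u v y)
    (hc21 : ∀ y, ∑ u, ∑ v, c2 u v y ≤ 1)
    (hj2 : ∀ u v y, G2 u v y → c2 u v y = pU u * k2 u v * Real.exp (j2 u v y))
    (hG2 : ∀ s u v w x y, 0 < pS s * r s u v w x → 0 < W2 x s y → G2 u w y)
    (hJ2 : ∑ z, ∑ y, μ z * W2 z.2.2.2.2 z.1 y * j2 z.2.1 z.2.2.2.1 y = J2) :
    ∃ V : ℝ, 0 ≤ V ∧ ∀ n : ℕ, 0 < n → ∀ δ : ℝ, 0 < δ → ∀ η : ℝ, 0 < η → ∀ L0 L1 L2 N : ℕ, 0 < L0 →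
      0 < L1 → 0 < L2 → 0 < N → ∀ τ : ℝ, 0 < τ →
      η + 2 * ((4 * (V / (n * δ ^ 2)) + (2 * (V / (n * δ ^ 2))) / η)
        + (1 + Real.exp (n * (I0 + δ)) + Real.exp (n * (I1 + δ)) / L1
          + Real.exp (n * (I2 + δ)) / L2
          + Real.exp (n * (I1 + I2 - I0 + Ic + 4 * δ)) / (L1 * L2)) / L0)
        + N * (2 * (L0 * (L1 * Real.exp (-(n * (J1 - δ))) + L2 * Real.exp (-(n * (J2 - δ))))))
        ≤ τ →
      ∃ M : ℕ, N ≤ 2 * M ∧ ∃ (φ : Fin M → (Fin n → S) → (Fin n → X)) (ψ : (Fin n → Y) → Fin M),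
      ∀ m,
      (∑ s : Fin n → S, (∏ i, pS (s i)) * ∑ y : Fin n → Y,
        (∏ i, W1 (φ m s i) (s i) (y i)) * (if ψ y ≠ m then 1 else 0)) ≤ 2 * τ ∧
      (∑ s : Fin n → S, (∏ i, pS (s i)) * ∑ y : Fin n → Y,
        (∏ i, W2 (φ m s i) (s i) (y i)) * (if ψ y ≠ m then 1 else 0)) ≤ 2 * τ := by
  have hμ0 : ∀ z, 0 ≤ μ z := fun z => by rw [hμ]; exact mul_nonneg (hS _) (hr _ _ _ _ _)
  have hμ1 : ∑ z, μ z = 1 := by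
    simp_rw [hμ, Fintype.sum_prod_type, ← Finset.mul_sum, hr1, mul_one, hS1]
  have hq0 : ∀ s u v w, 0 ≤ q s u v w := fun s u v w => by
    rw [hq]; exact Finset.sum_nonneg fun x _ => hr _ _ _ _ _
  have hq1 : ∀ s, ∑ u, ∑ v, ∑ w, q s u v w = 1 := fun s => by simp_rw [hq, hr1]
  set X0 := ∑ z, μ z * (d0 z.1 z.2.1 - I0) ^ 2 with hX0
  set X1 := ∑ z, μ z * (d1 z.1 z.2.1 z.2.2.1 - I1) ^ 2 with hX1
  set X2 := ∑ z, μ z * (d2 z.1 z.2.1 z.2.2.2.1 - I2) ^ 2 with hX2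
  set Xc := ∑ z, μ z * (dc z.1 z.2.1 z.2.2.1 z.2.2.2.1 - Ic) ^ 2 with hXc
  set X3 := ∑ z : (S × U × V1 × V2 × X) × Y, μ z.1 * W1 z.1.2.2.2.2 z.1.1 z.2 *
    (- j1 z.1.2.1 z.1.2.2.1 z.2 - (- J1)) ^ 2 with hX3
  set X4 := ∑ z : (S × U × V1 × V2 × X) × Y, μ z.1 * W2 z.1.2.2.2.2 z.1.1 z.2 *
    (- j2 z.1.2.1 z.1.2.2.2.1 z.2 - (- J2)) ^ 2 with hX4
  have p0 : 0 ≤ X0 := Finset.sum_nonneg fun z _ => mul_nonneg (hμ0 z) (sq_nonneg _)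
  have p1 : 0 ≤ X1 := Finset.sum_nonneg fun z _ => mul_nonneg (hμ0 z) (sq_nonneg _)
  have p2 : 0 ≤ X2 := Finset.sum_nonneg fun z _ => mul_nonneg (hμ0 z) (sq_nonneg _)
  have pc : 0 ≤ Xc := Finset.sum_nonneg fun z _ => mul_nonneg (hμ0 z) (sq_nonneg _)
  have p3 : 0 ≤ X3 := Finset.sum_nonneg fun z _ =>
    mul_nonneg (mul_nonneg (hμ0 _) (hW10 _ _ _)) (sq_nonneg _)
  have p4 : 0 ≤ X4 := Finset.sum_nonneg fun z _ =>
    mul_nonneg (mul_nonneg (hμ0 _) (hW20 _ _ _)) (sq_nonneg _)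
  refine ⟨X0 + X1 + X2 + Xc + X3 + X4, by positivity, ?_⟩
  intro n hn δ hδ η hη L0 L1 L2 N hL0 hL1 hL2 hN τ hτ hτ'
  set V := X0 + X1 + X2 + Xc + X3 + X4 with hV
  have hn' : (0 : ℝ) < n := by exact_mod_cast hn
  -- tests
  obtain ⟨T1, hT1⟩ : ∃ T : (Fin n → U) → (Fin n → V1) → (Fin n → Y) → Prop, T = fun u v y =>
    (∀ i, G1 (u i) (v i) (y i)) ∧ n * (J1 - δ) ≤ ∑ i, j1 (u i) (v i) (y i) := ⟨_, rfl⟩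
  obtain ⟨T2, hT2⟩ : ∃ T : (Fin n → U) → (Fin n → V2) → (Fin n → Y) → Prop, T = fun u v y =>
    (∀ i, G2 (u i) (v i) (y i)) ∧ n * (J2 - δ) ≤ ∑ i, j2 (u i) (v i) (y i) := ⟨_, rfl⟩
  set F1 : (Fin n → S × U × V1 × V2 × X) → ℝ := fun z => ∑ y : Fin n → Y,
    (∏ i, W1 (z i).2.2.2.2 (z i).1 (y i)) *
      (if T1 (fun i => (z i).2.1) (fun i => (z i).2.2.1) y then 0 else 1) with hF1
  set F2 : (Fin n → S × U × V1 × V2 × X) → ℝ := fun z => ∑ y : Fin n → Y,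
    (∏ i, W2 (z i).2.2.2.2 (z i).1 (y i)) *
      (if T2 (fun i => (z i).2.1) (fun i => (z i).2.2.2.1) y then 0 else 1) with hF2
  have ite01 : ∀ (p : Prop) [Decidable p], (0 : ℝ) ≤ if p then 0 else 1 := fun p _ => by
    split_ifs <;> norm_num
  have hF10 : ∀ z, 0 ≤ F1 z := fun z => Finset.sum_nonneg fun y _ =>
    mul_nonneg (Finset.prod_nonneg fun i _ => hW10 _ _ _) (ite01 _)
  have hF20 : ∀ z, 0 ≤ F2 z := fun z => Finset.sum_nonneg fun y _ =>
    mul_nonneg (Finset.prod_nonneg fun i _ => hW20 _ _ _) (ite01 _)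
  set B : (Fin n → S × U × V1 × V2 × X) → Prop := fun z =>
    (∀ i, 0 < μ (z i)) ∧ (∑ i, d0 (z i).1 (z i).2.1 ≤ n * (I0 + δ)) ∧
    (∑ i, d1 (z i).1 (z i).2.1 (z i).2.2.1 ≤ n * (I1 + δ)) ∧
    (∑ i, d2 (z i).1 (z i).2.1 (z i).2.2.2.1 ≤ n * (I2 + δ)) ∧
    (∑ i, dc (z i).1 (z i).2.1 (z i).2.2.1 (z i).2.2.2.1 ≤ n * (Ic + δ)) ∧
    (n * (I0 - δ) ≤ ∑ i, d0 (z i).1 (z i).2.1) ∧ F1 z + F2 z ≤ η with hB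
  have hbq1 : ∀ s : Fin n → S, ∑ u : Fin n → U, ∑ v : Fin n → V1, ∑ w : Fin n → V2,
      ∏ i, q (s i) (u i) (v i) (w i) = 1 := fun s => by
    have e1 : ∀ (u : Fin n → U) (v : Fin n → V1), ∑ w : Fin n → V2,
        ∏ i, q (s i) (u i) (v i) (w i) = ∏ i, ∑ w, q (s i) (u i) (v i) w := fun u v =>
      sum_pi_prod (fun i w => q (s i) (u i) (v i) w)
    have e2 : ∀ (u : Fin n → U), ∑ v : Fin n → V1,
        ∏ i, ∑ w, q (s i) (u i) (v i) w = ∏ i, ∑ v, ∑ w, q (s i) (u i) v w := fun u =>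
      sum_pi_prod (fun i v => ∑ w, q (s i) (u i) v w)
    simp_rw [e1, e2]
    rw [sum_pi_prod (fun i u => ∑ v, ∑ w, q (s i) u v w)]
    simp [hq1]
  have hqr : ∀ (s : Fin n → S) (u : Fin n → U) (v : Fin n → V1) (w : Fin n → V2),
      ∏ i, q (s i) (u i) (v i) (w i) = ∑ x : Fin n → X, ∏ i, r (s i) (u i) (v i) (w i) (x i) :=
    fun s u v w => by
      rw [sum_pi_prod (fun i x => r (s i) (u i) (v i) (w i) x)]
      simp_rw [hq]
  obtain ⟨A, hA⟩ : ∃ A : (Fin n → S) → (Fin n → U) → (Fin n → V1) → (Fin n → V2) → Prop,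
      A = fun s u v w =>
    ∃ x : Fin n → X, B (fun i => (s i, u i, v i, w i, x i)) := ⟨_, rfl⟩
  have hpos : ∀ s u v w x, 0 < μ (s, u, v, w, x) → 0 < pS s ∧ 0 < r s u v w x := by
    intro s u v w x h
    rw [hμ] at h
    simp only at h
    constructor
    · refine lt_of_le_of_ne (hS s) (fun h' => ?_)
      rw [← h'] at h; simp at h
    · refine lt_of_le_of_ne (hr _ _ _ _ _) (fun h' => ?_)
      rw [← h'] at h; simp at h
  refine oneshot (S := Fin n → S) (U := Fin n → U) (V1 := Fin n → V1) (V2 := Fin n → V2)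
    (X := Fin n → X) (Y := Fin n → Y) hL0 hL1 hL2 (pS := fun s => ∏ i, pS (s i))
    (W1 := fun x s y => ∏ i, W1 (x i) (s i) (y i)) (W2 := fun x s y => ∏ i, W2 (x i) (s i) (y i))
    (pU := fun u => ∏ i, pU (u i)) (k1 := fun u v => ∏ i, k1 (u i) (v i))
    (k2 := fun u v => ∏ i, k2 (u i) (v i)) (q := fun s u v w => ∏ i, q (s i) (u i) (v i) (w i))
    (pi_nonneg hS) (pi_sum_one hS1)
    (fun x s y => Finset.prod_nonneg fun i _ => hW10 _ _ _)
    (fun x s y => Finset.prod_nonneg fun i _ => hW20 _ _ _)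
    ?_ ?_ (pi_nonneg hU) (fun x y => Finset.prod_nonneg fun i _ => h1 _ _)
    (fun x y => Finset.prod_nonneg fun i _ => h2 _ _) (pi_sum_one hU1) (ker_sum h11) (ker_sum h21)
    (fun s u v w => Finset.prod_nonneg fun i _ => hq0 _ _ _ _) hbq1 A
    (Real.exp_nonneg _) (Real.exp_nonneg _) (Real.exp_nonneg _) (Real.exp_nonneg _)
    ?_ ?_ ?_ ?_ T1 T2 (Real.exp_nonneg _) (Real.exp_nonneg _) ?_ ?_ hη.le ?_ ?_ hτ hτ' hN
  · intro x s
    rw [sum_pi_prod (fun i y => W1 (x i) (s i) y)]; simp [hW11]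
  · intro x s
    rw [sum_pi_prod (fun i y => W2 (x i) (s i) y)]; simp [hW21]
  · intro s u v w hAA
    rw [hA] at hAA
    obtain ⟨x, b1, b2, b3, b4, b5, b6, b7⟩ := hAA
    have e1 : ∀ v : Fin n → V1, ∑ w : Fin n → V2,
        ∏ i, q (s i) (u i) (v i) (w i) = ∏ i, ∑ w, q (s i) (u i) (v i) w := fun v =>
      sum_pi_prod (fun i w => q (s i) (u i) (v i) w)
    have e2 : ∑ v : Fin n → V1,
        ∏ i, ∑ w, q (s i) (u i) (v i) w = ∏ i, ∑ v, ∑ w, q (s i) (u i) v w :=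
      sum_pi_prod (fun i v => ∑ w, q (s i) (u i) v w)
    simp only [e1, e2]
    exact prod_exp_bound (fun i => hU _) (fun i => hd0 _ _ (v i) (w i) (x i)
      (hpos _ _ _ _ _ (b1 i)).1 (hpos _ _ _ _ _ (b1 i)).2) b2
  · intro s u v w hAA
    rw [hA] at hAA
    obtain ⟨x, b1, b2, b3, b4, b5, b6, b7⟩ := hAA
    have e1 : ∑ w : Fin n → V2,
        ∏ i, q (s i) (u i) (v i) (w i) = ∏ i, ∑ w, q (s i) (u i) (v i) w :=
      sum_pi_prod (fun i w => q (s i) (u i) (v i) w)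
    simp only [e1, ← Finset.prod_mul_distrib]
    exact prod_exp_bound (fun i => mul_nonneg (hU _) (h1 _ _)) (fun i => hd1 _ _ (v i) (w i) (x i)
      (hpos _ _ _ _ _ (b1 i)).1 (hpos _ _ _ _ _ (b1 i)).2) b3
  · intro s u v w hAA
    rw [hA] at hAA
    obtain ⟨x, b1, b2, b3, b4, b5, b6, b7⟩ := hAA
    have e1 : ∑ v : Fin n → V1,
        ∏ i, q (s i) (u i) (v i) (w i) = ∏ i, ∑ v, q (s i) (u i) v (w i) :=
      sum_pi_prod (fun i v => q (s i) (u i) v (w i))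
    simp only [e1, ← Finset.prod_mul_distrib]
    exact prod_exp_bound (fun i => mul_nonneg (hU _) (h2 _ _)) (fun i => hd2 _ _ (v i) (w i) (x i)
      (hpos _ _ _ _ _ (b1 i)).1 (hpos _ _ _ _ _ (b1 i)).2) b4
  · intro s u v w hAA
    rw [hA] at hAA
    obtain ⟨x, b1, b2, b3, b4, b5, b6, b7⟩ := hAA
    simp only [← Finset.prod_mul_distrib]
    refine prod_exp_bound (fun i => mul_nonneg (mul_nonneg (hU _) (h1 _ _)) (h2 _ _))
      (fun i => hdc _ _ (v i) (w i) (x i)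
      (hpos _ _ _ _ _ (b1 i)).1 (hpos _ _ _ _ _ (b1 i)).2) ?_
    rw [Finset.sum_add_distrib, Finset.sum_sub_distrib, Finset.sum_add_distrib]
    simp only at b3 b4 b5 b6
    linarith
  · intro y
    exact test_bound G1 j1 c1 hc1 hc11 hj1 _ y (fun u v => T1 u v y)
      (fun u v h => by rw [hT1] at h; exact h)
  · intro y
    exact test_bound G2 j2 c2 hc2 hc21 hj2 _ y (fun u v => T2 u v y)
      (fun u v h => by rw [hT2] at h; exact h)
  · intro s u v w hAA
    rw [hA] at hAA
    obtain ⟨x, b1, b2, b3, b4, b5, b6, b7⟩ := hAA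
    exact ⟨x, b7⟩
  · have hnb : ∀ z : Fin n → S × U × V1 × V2 × X, 0 ≤ ∏ i, μ (z i) := fun z => pi_nonneg hμ0 z
    have step1 : ∑ s : Fin n → S, (∏ i, pS (s i)) * (1 - ∑ u, ∑ v, ∑ w, if A s u v w then
        ∏ i, q (s i) (u i) (v i) (w i) else 0) = ∑ z : Fin n → S × U × V1 × V2 × X,
        (∏ i, μ (z i)) * (if A (fun i => (z i).1) (fun i => (z i).2.1) (fun i => (z i).2.2.1)
          (fun i => (z i).2.2.2.1) then 0 else 1) := by
      rw [blk2]
      refine Finset.sum_congr rfl fun s _ => ?_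
      have e1 : (1 - ∑ u, ∑ v, ∑ w, if A s u v w then
          ∏ i, q (s i) (u i) (v i) (w i) else 0) = (∑ u : Fin n → U, ∑ v : Fin n → V1,
          ∑ w : Fin n → V2, ∏ i, q (s i) (u i) (v i) (w i)) - ∑ u, ∑ v, ∑ w, if A s u v w then
          ∏ i, q (s i) (u i) (v i) (w i) else 0 := by rw [hbq1]
      rw [blk2, e1, ← Finset.sum_sub_distrib, Finset.mul_sum]
      refine Finset.sum_congr rfl fun u _ => ?_
      rw [blk2, ← Finset.sum_sub_distrib, Finset.mul_sum]
      refine Finset.sum_congr rfl fun v _ => ?_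
      rw [blk2, ← Finset.sum_sub_distrib, Finset.mul_sum]
      refine Finset.sum_congr rfl fun w _ => ?_
      simp only [hμ, Finset.prod_mul_distrib]
      by_cases h : A s u v w
      · simp [h]
      · simp only [h, if_false, mul_one]
        rw [← Finset.mul_sum, ← hqr, sub_zero]
    rw [step1]
    have c0 := cheb hμ0 hμ1 (fun z => d0 z.1 z.2.1) hI0 hn hδ
    have c0' := cheb hμ0 hμ1 (fun z => - d0 z.1 z.2.1) (I := -I0) (by
      simp_rw [mul_neg, Finset.sum_neg_distrib, hI0]) hn hδ
    have c1 := cheb hμ0 hμ1 (fun z => d1 z.1 z.2.1 z.2.2.1) hI1 hn hδ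
    have c2 := cheb hμ0 hμ1 (fun z => d2 z.1 z.2.1 z.2.2.2.1) hI2 hn hδ
    have cc := cheb hμ0 hμ1 (fun z => dc z.1 z.2.1 z.2.2.1 z.2.2.2.1) hIc hn hδ
    have f1 := failbound hμ0 hμ1 (W := fun z y => W1 z.2.2.2.2 z.1 y) (fun _ _ => hW10 _ _ _)
      (fun _ => hW11 _ _) (fun z y => j1 z.2.1 z.2.2.1 y) (fun z y => G1 z.2.1 z.2.2.1 y)
      (fun z y hz hy => by rw [hμ] at hz; exact hG1 _ _ _ _ _ _ hz hy) hJ1 hn hδ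
      (fun z y => T1 (fun i => (z i).2.1) (fun i => (z i).2.2.1) y) (fun z y ha hb => by rw [hT1]; exact ⟨ha, hb⟩)
    have f2 := failbound hμ0 hμ1 (W := fun z y => W2 z.2.2.2.2 z.1 y) (fun _ _ => hW20 _ _ _)
      (fun _ => hW21 _ _) (fun z y => j2 z.2.1 z.2.2.2.1 y) (fun z y => G2 z.2.1 z.2.2.2.1 y)
      (fun z y hz hy => by rw [hμ] at hz; exact hG2 _ _ _ _ _ _ hz hy) hJ2 hn hδ
      (fun z y => T2 (fun i => (z i).2.1) (fun i => (z i).2.2.2.1) y) (fun z y ha hb => by rw [hT2]; exact ⟨ha, hb⟩)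
    have hX0' : ∑ z, μ z * (- d0 z.1 z.2.1 - - I0) ^ 2 = X0 := by
      rw [hX0]; exact Finset.sum_congr rfl fun z _ => by ring
    rw [hX0'] at c0'
    have hD : (0 : ℝ) < n * δ ^ 2 := by positivity
    have step2 : ∀ z : Fin n → S × U × V1 × V2 × X,
        (∏ i, μ (z i)) * (if A (fun i => (z i).1) (fun i => (z i).2.1) (fun i => (z i).2.2.1)
          (fun i => (z i).2.2.2.1) then 0 else 1) ≤
        (∏ i, μ (z i)) * (if ∑ i, d0 (z i).1 (z i).2.1 ≤ n * (I0 + δ) then 0 else 1)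
        + (∏ i, μ (z i)) * (if ∑ i, - d0 (z i).1 (z i).2.1 ≤ n * (- I0 + δ) then 0 else 1)
        + (∏ i, μ (z i)) * (if ∑ i, d1 (z i).1 (z i).2.1 (z i).2.2.1 ≤ n * (I1 + δ) then 0 else 1)
        + (∏ i, μ (z i)) *
          (if ∑ i, d2 (z i).1 (z i).2.1 (z i).2.2.2.1 ≤ n * (I2 + δ) then 0 else 1)
        + (∏ i, μ (z i)) *
          (if ∑ i, dc (z i).1 (z i).2.1 (z i).2.2.1 (z i).2.2.2.1 ≤ n * (Ic + δ) then 0 else 1)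
        + ((∏ i, μ (z i)) * F1 z) / η + ((∏ i, μ (z i)) * F2 z) / η := by
      intro z
      simp only [mul_div_assoc, ← mul_add]
      by_cases hz : ∏ i, μ (z i) = 0
      · rw [hz]; simp
      refine mul_le_mul_of_nonneg_left ?_ (hnb z)
      have g1 : 0 ≤ F1 z / η := div_nonneg (hF10 z) hη.le
      have g2 : 0 ≤ F2 z / η := div_nonneg (hF20 z) hη.le
      have a0 := ite01 (∑ i, d0 (z i).1 (z i).2.1 ≤ n * (I0 + δ))
      have a0' := ite01 (∑ i, - d0 (z i).1 (z i).2.1 ≤ n * (- I0 + δ))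
      have a1 := ite01 (∑ i, d1 (z i).1 (z i).2.1 (z i).2.2.1 ≤ n * (I1 + δ))
      have a2 := ite01 (∑ i, d2 (z i).1 (z i).2.1 (z i).2.2.2.1 ≤ n * (I2 + δ))
      have ac := ite01 (∑ i, dc (z i).1 (z i).2.1 (z i).2.2.1 (z i).2.2.2.1 ≤ n * (Ic + δ))
      have up : ∀ (p : Prop) [Decidable p], (if p then (0 : ℝ) else 1) ≤ 1 := fun p _ => by
        split_ifs <;> norm_num
      have uA := up (A (fun i => (z i).1) (fun i => (z i).2.1) (fun i => (z i).2.2.1)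
          (fun i => (z i).2.2.2.1))
      by_cases q0 : ∑ i, d0 (z i).1 (z i).2.1 ≤ n * (I0 + δ)
      swap
      · rw [if_neg q0]; linarith
      by_cases q0' : ∑ i, - d0 (z i).1 (z i).2.1 ≤ n * (- I0 + δ)
      swap
      · rw [if_neg q0']; linarith
      by_cases q1 : ∑ i, d1 (z i).1 (z i).2.1 (z i).2.2.1 ≤ n * (I1 + δ)
      swap
      · rw [if_neg q1]; linarith
      by_cases q2 : ∑ i, d2 (z i).1 (z i).2.1 (z i).2.2.2.1 ≤ n * (I2 + δ)
      swap
      · rw [if_neg q2]; linarith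
      by_cases qc : ∑ i, dc (z i).1 (z i).2.1 (z i).2.2.1 (z i).2.2.2.1 ≤ n * (Ic + δ)
      swap
      · rw [if_neg qc]; linarith
      by_cases qf : F1 z + F2 z ≤ η
      swap
      · have : 1 ≤ F1 z / η + F2 z / η := by
          rw [← add_div, le_div_iff₀ hη]; linarith
        linarith
      have hAA : A (fun i => (z i).1) (fun i => (z i).2.1) (fun i => (z i).2.2.1)
          (fun i => (z i).2.2.2.1) := by
        rw [hA]
        refine ⟨fun i => (z i).2.2.2.2, fun i => ?_, q0, q1, q2, qc, ?_, qf⟩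
        · rw [Finset.prod_eq_zero_iff] at hz
          push Not at hz
          exact lt_of_le_of_ne (hμ0 _) (fun h => hz i (Finset.mem_univ _) h.symm)
        · rw [Finset.sum_neg_distrib] at q0'
          show n * (I0 - δ) ≤ ∑ i, d0 (z i).1 (z i).2.1
          linarith
      rw [if_pos hAA]
      linarith
    refine (Finset.sum_le_sum fun z _ => step2 z).trans ?_
    simp only [Finset.sum_add_distrib, ← Finset.sum_div]
    have f1' : (∑ z, (∏ i, μ (z i)) * F1 z) / η ≤ (X3 / (n * δ ^ 2)) / η := by
      gcongr
    have f2' : (∑ z, (∏ i, μ (z i)) * F2 z) / η ≤ (X4 / (n * δ ^ 2)) / η := by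
      gcongr
    have m1 : 2 * X0 + X1 + X2 + Xc ≤ 4 * V := by rw [hV]; linarith
    have m2 : X3 + X4 ≤ 2 * V := by rw [hV]; linarith
    have n1 : X0 / (n * δ ^ 2) + X0 / (n * δ ^ 2) + X1 / (n * δ ^ 2) + X2 / (n * δ ^ 2)
        + Xc / (n * δ ^ 2) ≤ 4 * (V / (n * δ ^ 2)) := by
      rw [← add_div, ← add_div, ← add_div, ← add_div, ← mul_div_assoc]
      gcongr; linarith
    have n2 : X3 / (n * δ ^ 2) / η + X4 / (n * δ ^ 2) / η ≤ 2 * (V / (n * δ ^ 2)) / η := by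
      rw [← add_div, ← add_div, ← mul_div_assoc]
      gcongr
    linarith

lemma ker_exists {A B : Type} [Fintype B] [Nonempty B] (f : A → B → ℝ) (hf : ∀ a b, 0 ≤ f a b) :
    ∃ k : A → B → ℝ, (∀ a b, 0 ≤ k a b) ∧ (∀ a, ∑ b, k a b = 1) ∧
      ∀ a b, f a b = (∑ b', f a b') * k a b := by
  have : ∀ a, ∃ k : B → ℝ, (∀ b, 0 ≤ k b) ∧ (∑ b, k b = 1) ∧
      ∀ b, f a b = (∑ b', f a b') * k b := by
    intro a
    by_cases h : ∑ b', f a b' = 0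
    · refine ⟨fun b => 1 / Fintype.card B, fun b => by positivity, ?_, fun b => ?_⟩
      · simp
      · rw [h, zero_mul]
        exact (Finset.sum_eq_zero_iff_of_nonneg (fun b _ => hf a b)).1 h b (Finset.mem_univ _)
    · refine ⟨fun b => f a b / ∑ b', f a b', fun b => div_nonneg (hf _ _)
        (Finset.sum_nonneg fun b _ => hf _ _), ?_, fun b => ?_⟩
      · rw [← Finset.sum_div, div_self h]
      · field_simp
  choose k hk using this
  exact ⟨k, fun a => (hk a).1, fun a => (hk a).2.1, fun a => (hk a).2.2⟩

lemma gibbs {Z : Type} [Fintype Z] {μ ν : Z → ℝ} (h0 : ∀ z, 0 ≤ μ z) (h1 : ∑ z, μ z = 1)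
    (hν : ∀ z, 0 ≤ ν z) (hν1 : ∑ z, ν z ≤ 1) (d : Z → ℝ)
    (h : ∀ z, 0 < μ z → μ z * Real.exp (- d z) ≤ ν z) : 0 ≤ ∑ z, μ z * d z := by
  have : ∑ z, (μ z - ν z) ≤ ∑ z, μ z * d z := by
    refine Finset.sum_le_sum fun z _ => ?_
    rcases (h0 z).eq_or_lt with hz | hz
    · rw [← hz]; have := hν z; linarith
    · have a := h z hz
      have b := Real.add_one_le_exp (- d z)
      have c := mul_le_mul_of_nonneg_left b (h0 z)
      linarith
  rw [Finset.sum_sub_distrib, h1] at this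
  linarith

section letter
variable {S U V1 V2 X Y : Type} [Fintype S] [Fintype U] [Fintype V1] [Fintype V2]
    [Fintype X] [Fintype Y]

lemma comm3 {A B C : Type} [Fintype A] [Fintype B] [Fintype C] (F : A → B → C → ℝ) :
    ∑ a, ∑ b, ∑ c, F a b c = ∑ c, ∑ a, ∑ b, F a b c := by
  rw [Finset.sum_comm (s := (Finset.univ : Finset C))]
  exact Finset.sum_congr rfl fun a _ => Finset.sum_comm

lemma comm4 {A B C D : Type} [Fintype A] [Fintype B] [Fintype C] [Fintype D]
    (F : A → B → C → D → ℝ) :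
    ∑ a, ∑ b, ∑ c, ∑ d, F a b c d = ∑ d, ∑ c, ∑ a, ∑ b, F a b c d := by
  rw [Finset.sum_comm (s := (Finset.univ : Finset D))]
  rw [comm3 (fun a b c => ∑ d, F a b c d)]
  refine Finset.sum_congr rfl fun c _ => ?_
  rw [comm3 (fun a b d => F a b c d)]

lemma comm4' {A B C D : Type} [Fintype A] [Fintype B] [Fintype C] [Fintype D]
    (F : A → B → C → D → ℝ) :
    ∑ a, ∑ b, ∑ c, ∑ d, F a b c d = ∑ c, ∑ b, ∑ d, ∑ a, F a b c d := by
  rw [Finset.sum_comm]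
  rw [Finset.sum_comm (s := (Finset.univ : Finset C))]
  refine Finset.sum_congr rfl fun b _ => ?_
  rw [Finset.sum_comm]
  refine Finset.sum_congr rfl fun c _ => ?_
  rw [Finset.sum_comm]

lemma miC {pS : S → ℝ} {W : X → S → Y → ℝ} (hW1 : ∀ x s, ∑ y, W x s y = 1)
    {r : S → U → V1 → V2 → X → ℝ} {q : S → U → V1 → V2 → ℝ}
    (hq : ∀ s u v w, q s u v w = ∑ x, r s u v w x) :
    condMutualInfo (fun z : V1 × V2 × (U × S) => ∑ x, ∑ y,
      pS z.2.2.2 * r z.2.2.2 z.2.2.1 z.1 z.2.1 x * W x z.2.2.2 y) =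
    ∑ z : S × U × V1 × V2 × X, pS z.1 * r z.1 z.2.1 z.2.2.1 z.2.2.2.1 z.2.2.2.2 *
      Real.log ((pS z.1 * q z.1 z.2.1 z.2.2.1 z.2.2.2.1) * (pS z.1 * ∑ v, ∑ w, q z.1 z.2.1 v w) /
        ((pS z.1 * ∑ w, q z.1 z.2.1 z.2.2.1 w) * (pS z.1 * ∑ v, q z.1 z.2.1 v z.2.2.2.1))) := by
  have hp : ∀ u v w s, ∑ x, ∑ y, pS s * r s u v w x * W x s y = pS s * q s u v w := by
    intro u v w s
    simp_rw [← Finset.mul_sum, hW1, mul_one, ← Finset.mul_sum, ← hq]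
  unfold condMutualInfo
  simp only [Fintype.sum_prod_type, hp]
  simp only [← Finset.sum_mul, ← Finset.mul_sum, ← hq]
  rw [comm4]

lemma miS1 {pS : S → ℝ} {W : X → S → Y → ℝ} (hW1 : ∀ x s, ∑ y, W x s y = 1)
    {r : S → U → V1 → V2 → X → ℝ} {q : S → U → V1 → V2 → ℝ}
    (hq : ∀ s u v w, q s u v w = ∑ x, r s u v w x) (hq1 : ∀ s, ∑ u, ∑ v, ∑ w, q s u v w = 1) :
    mutualInfo (fun z : (U × V1) × S => ∑ o : V2, ∑ x, ∑ y, pS z.2 * r z.2 z.1.1 z.1.2 o x * W x z.2 y) =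
    ∑ z : S × U × V1 × V2 × X, pS z.1 * r z.1 z.2.1 z.2.2.1 z.2.2.2.1 z.2.2.2.2 *
      Real.log ((pS z.1 * ∑ o, q z.1 z.2.1 z.2.2.1 o) / ((∑ s, pS s * ∑ o, q s z.2.1 z.2.2.1 o) * pS z.1)) := by
  have hp : ∀ u v s, ∑ o : V2, ∑ x, ∑ y, pS s * r s u v o x * W x s y = pS s * ∑ o, q s u v o := by
    intro u v s
    simp_rw [← Finset.mul_sum, hW1, mul_one, ← Finset.mul_sum, ← hq]
  have hm : ∀ s, ∑ u, ∑ v, pS s * ∑ o, q s u v o = pS s := by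
    intro s
    simp_rw [← Finset.mul_sum]
    have := hq1 s
    rw [this, mul_one]
  unfold mutualInfo
  simp only [Fintype.sum_prod_type, hp, hm]
  simp only [← Finset.sum_mul, ← Finset.mul_sum, ← hq]
  rw [comm3]
  

lemma miY1 {pS : S → ℝ} {W : X → S → Y → ℝ} (hW1 : ∀ x s, ∑ y, W x s y = 1)
    {r : S → U → V1 → V2 → X → ℝ} {q : S → U → V1 → V2 → ℝ}
    (hq : ∀ s u v w, q s u v w = ∑ x, r s u v w x) :
    mutualInfo (fun z : (U × V1) × Y => ∑ o : V2, ∑ s, ∑ x, pS s * r s z.1.1 z.1.2 o x * W x s z.2) =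
    ∑ z : S × U × V1 × V2 × X, ∑ y, pS z.1 * r z.1 z.2.1 z.2.2.1 z.2.2.2.1 z.2.2.2.2 *
      W z.2.2.2.2 z.1 y *
      Real.log ((∑ o : V2, ∑ s, ∑ x, pS s * r s z.2.1 z.2.2.1 o x * W x s y) /
        ((∑ s, pS s * ∑ o, q s z.2.1 z.2.2.1 o) * ∑ u, ∑ v : V1, ∑ o : V2, ∑ s, ∑ x, pS s * r s u v o x * W x s y)) := by
  have hm : ∀ u v, ∑ y, ∑ o : V2, ∑ s, ∑ x, pS s * r s u v o x * W x s y = ∑ s, pS s * ∑ o, q s u v o := by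
    intro u v
    rw [comm4']
    simp_rw [← Finset.mul_sum, hW1, mul_one, ← Finset.mul_sum, ← hq]
  unfold mutualInfo
  simp only [Fintype.sum_prod_type, hm, Finset.sum_mul]
  simp_rw [comm4' (A := Y)]
  rw [comm3]
  

lemma miS2 {pS : S → ℝ} {W : X → S → Y → ℝ} (hW1 : ∀ x s, ∑ y, W x s y = 1)
    {r : S → U → V1 → V2 → X → ℝ} {q : S → U → V1 → V2 → ℝ}
    (hq : ∀ s u v w, q s u v w = ∑ x, r s u v w x) (hq1 : ∀ s, ∑ u, ∑ v, ∑ w, q s u v w = 1) :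
    mutualInfo (fun z : (U × V2) × S => ∑ o : V1, ∑ x, ∑ y, pS z.2 * r z.2 z.1.1 o z.1.2 x * W x z.2 y) =
    ∑ z : S × U × V1 × V2 × X, pS z.1 * r z.1 z.2.1 z.2.2.1 z.2.2.2.1 z.2.2.2.2 *
      Real.log ((pS z.1 * ∑ o, q z.1 z.2.1 o z.2.2.2.1) / ((∑ s, pS s * ∑ o, q s z.2.1 o z.2.2.2.1) * pS z.1)) := by
  have hp : ∀ u v s, ∑ o : V1, ∑ x, ∑ y, pS s * r s u o v x * W x s y = pS s * ∑ o, q s u o v := by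
    intro u v s
    simp_rw [← Finset.mul_sum, hW1, mul_one, ← Finset.mul_sum, ← hq]
  have hm : ∀ s, ∑ u, ∑ v, pS s * ∑ o, q s u o v = pS s := by
    intro s
    simp_rw [← Finset.mul_sum]
    have := hq1 s
    simp_rw [Finset.sum_comm (s := (Finset.univ : Finset V1))] at this
    rw [this, mul_one]
  unfold mutualInfo
  simp only [Fintype.sum_prod_type, hp, hm]
  simp only [← Finset.sum_mul, ← Finset.mul_sum, ← hq]
  rw [comm3]
  refine Finset.sum_congr rfl fun s _ => Finset.sum_congr rfl fun u _ => ?_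
  rw [Finset.sum_comm]
  simp only [← Finset.sum_mul, ← Finset.mul_sum]

lemma miY2 {pS : S → ℝ} {W : X → S → Y → ℝ} (hW1 : ∀ x s, ∑ y, W x s y = 1)
    {r : S → U → V1 → V2 → X → ℝ} {q : S → U → V1 → V2 → ℝ}
    (hq : ∀ s u v w, q s u v w = ∑ x, r s u v w x) :
    mutualInfo (fun z : (U × V2) × Y => ∑ o : V1, ∑ s, ∑ x, pS s * r s z.1.1 o z.1.2 x * W x s z.2) =
    ∑ z : S × U × V1 × V2 × X, ∑ y, pS z.1 * r z.1 z.2.1 z.2.2.1 z.2.2.2.1 z.2.2.2.2 *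
      W z.2.2.2.2 z.1 y *
      Real.log ((∑ o : V1, ∑ s, ∑ x, pS s * r s z.2.1 o z.2.2.2.1 x * W x s y) /
        ((∑ s, pS s * ∑ o, q s z.2.1 o z.2.2.2.1) * ∑ u, ∑ v : V2, ∑ o : V1, ∑ s, ∑ x, pS s * r s u o v x * W x s y)) := by
  have hm : ∀ u v, ∑ y, ∑ o : V1, ∑ s, ∑ x, pS s * r s u o v x * W x s y = ∑ s, pS s * ∑ o, q s u o v := by
    intro u v
    rw [comm4']
    simp_rw [← Finset.mul_sum, hW1, mul_one, ← Finset.mul_sum, ← hq]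
  unfold mutualInfo
  simp only [Fintype.sum_prod_type, hm, Finset.sum_mul]
  simp_rw [comm4' (A := Y)]
  rw [comm3]
  refine Finset.sum_congr rfl fun s _ => Finset.sum_congr rfl fun u _ => ?_
  rw [Finset.sum_comm]

end letter

/-- The block coding conclusion. -/
def BlockProp {S X Y : Type} [Fintype S] [Fintype Y] (pS : S → ℝ) (W1 W2 : X → S → Y → ℝ)
    (I0 I1 I2 Ic J1 J2 V : ℝ) : Prop :=
  ∀ n : ℕ, 0 < n → ∀ δ : ℝ, 0 < δ → ∀ η : ℝ, 0 < η → ∀ L0 L1 L2 N : ℕ, 0 < L0 →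
      0 < L1 → 0 < L2 → 0 < N → ∀ τ : ℝ, 0 < τ →
      η + 2 * ((4 * (V / (n * δ ^ 2)) + (2 * (V / (n * δ ^ 2))) / η)
        + (1 + Real.exp (n * (I0 + δ)) + Real.exp (n * (I1 + δ)) / L1
          + Real.exp (n * (I2 + δ)) / L2
          + Real.exp (n * (I1 + I2 - I0 + Ic + 4 * δ)) / (L1 * L2)) / L0)
        + N * (2 * (L0 * (L1 * Real.exp (-(n * (J1 - δ))) + L2 * Real.exp (-(n * (J2 - δ))))))
        ≤ τ →
      ∃ M : ℕ, N ≤ 2 * M ∧ ∃ (φ : Fin M → (Fin n → S) → (Fin n → X)) (ψ : (Fin n → Y) → Fin M),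
      ∀ m,
      (∑ s : Fin n → S, (∏ i, pS (s i)) * ∑ y : Fin n → Y,
        (∏ i, W1 (φ m s i) (s i) (y i)) * (if ψ y ≠ m then 1 else 0)) ≤ 2 * τ ∧
      (∑ s : Fin n → S, (∏ i, pS (s i)) * ∑ y : Fin n → Y,
        (∏ i, W2 (φ m s i) (s i) (y i)) * (if ψ y ≠ m then 1 else 0)) ≤ 2 * τ

set_option maxHeartbeats 4000000 in
lemma lettercode {S U V1 V2 X Y : Type} [Fintype S] [Fintype U] [Fintype V1] [Fintype V2]
    [Fintype X] [Fintype Y] [Nonempty X] [Nonempty V1] [Nonempty V2]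
    {pS : S → ℝ} (hS : ∀ s, 0 ≤ pS s) (hS1 : ∑ s, pS s = 1)
    {W1 W2 : X → S → Y → ℝ} (hW10 : ∀ x s y, 0 ≤ W1 x s y) (hW20 : ∀ x s y, 0 ≤ W2 x s y)
    (hW11 : ∀ x s, ∑ y, W1 x s y = 1) (hW21 : ∀ x s, ∑ y, W2 x s y = 1)
    {r : S → U → V1 → V2 → X → ℝ} (hr : ∀ s u v w x, 0 ≤ r s u v w x)
    (hr1 : ∀ s, ∑ u, ∑ v, ∑ w, ∑ x, r s u v w x = 1) :
    ∃ I0 I1 I2 Ic J1 J2 V : ℝ, 0 ≤ I0 ∧ I0 ≤ I1 ∧ I0 ≤ I2 ∧ 0 ≤ Ic ∧ 0 ≤ V ∧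
    mutualInfo (fun z : (U × V1) × Y => ∑ o : V2, ∑ s, ∑ x,
      pS s * r s z.1.1 z.1.2 o x * W1 x s z.2) = J1 ∧
    mutualInfo (fun z : (U × V1) × S => ∑ o : V2, ∑ x, ∑ y,
      pS z.2 * r z.2 z.1.1 z.1.2 o x * W1 x z.2 y) = I1 ∧
    mutualInfo (fun z : (U × V2) × Y => ∑ o : V1, ∑ s, ∑ x,
      pS s * r s z.1.1 o z.1.2 x * W2 x s z.2) = J2 ∧
    mutualInfo (fun z : (U × V2) × S => ∑ o : V1, ∑ x, ∑ y,
      pS z.2 * r z.2 z.1.1 o z.1.2 x * W2 x z.2 y) = I2 ∧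
    condMutualInfo (fun z : V1 × V2 × (U × S) => ∑ x, ∑ y,
      pS z.2.2.2 * r z.2.2.2 z.2.2.1 z.1 z.2.1 x * W1 x z.2.2.2 y) = Ic ∧
    BlockProp pS W1 W2 I0 I1 I2 Ic J1 J2 V := by
  obtain ⟨q, hq⟩ : ∃ q : S → U → V1 → V2 → ℝ, ∀ s u v w, q s u v w = ∑ x, r s u v w x :=
    ⟨_, fun _ _ _ _ => rfl⟩
  have hq1 : ∀ s, ∑ u, ∑ v, ∑ w, q s u v w = 1 := fun s => by simp_rw [hq, hr1]
  have hq0 : ∀ s u v w, 0 ≤ q s u v w := fun s u v w => by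
    rw [hq]; exact Finset.sum_nonneg fun x _ => hr _ _ _ _ _
  have hqr : ∀ s u v w x, r s u v w x ≤ q s u v w := fun s u v w x => by
    rw [hq]
    exact Finset.single_le_sum (f := fun x => r s u v w x) (fun x _ => hr _ _ _ _ _) (Finset.mem_univ x)
  rw [miS1 hW11 hq hq1, miS2 hW21 hq hq1, miY1 hW11 hq, miY2 hW21 hq, miC hW11 hq]
  set Q1 : S → U → V1 → ℝ := fun s u v => ∑ w, q s u v w with hQ1
  set Q2 : S → U → V2 → ℝ := fun s u w => ∑ v, q s u v w with hQ2
  set QU : S → U → ℝ := fun s u => ∑ v, ∑ w, q s u v w with hQU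
  have hQ10 : ∀ s u v, 0 ≤ Q1 s u v := fun s u v => Finset.sum_nonneg fun w _ => hq0 _ _ _ _
  have hQ20 : ∀ s u v, 0 ≤ Q2 s u v := fun s u v => Finset.sum_nonneg fun w _ => hq0 _ _ _ _
  have hQU0 : ∀ s u, 0 ≤ QU s u := fun s u => Finset.sum_nonneg fun w _ => hQ10 _ _ _
  have hqQ1 : ∀ s u v w, q s u v w ≤ Q1 s u v := fun s u v w =>
    Finset.single_le_sum (f := fun w => q s u v w) (fun _ _ => hq0 _ _ _ _) (Finset.mem_univ w)
  have hqQ2 : ∀ s u v w, q s u v w ≤ Q2 s u w := fun s u v w =>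
    Finset.single_le_sum (f := fun v => q s u v w) (fun _ _ => hq0 _ _ _ _) (Finset.mem_univ v)
  have hQQ1 : ∀ s u v, Q1 s u v ≤ QU s u := fun s u v =>
    Finset.single_le_sum (f := fun v => Q1 s u v) (fun _ _ => hQ10 _ _ _) (Finset.mem_univ v)
  have hQU2 : ∀ s u, ∑ w, Q2 s u w = QU s u := fun s u => by
    simp only [hQ2, hQU]; rw [Finset.sum_comm]
  have hQUs : ∀ s, ∑ u, QU s u = 1 := hq1
  set P1 : U → V1 → ℝ := fun u v => ∑ s, pS s * Q1 s u v with hP1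
  set P2 : U → V2 → ℝ := fun u v => ∑ s, pS s * Q2 s u v with hP2
  set pU : U → ℝ := fun u => ∑ s, pS s * QU s u with hpU
  have hP10 : ∀ u v, 0 ≤ P1 u v := fun u v => Finset.sum_nonneg fun s _ =>
    mul_nonneg (hS _) (hQ10 _ _ _)
  have hP20 : ∀ u v, 0 ≤ P2 u v := fun u v => Finset.sum_nonneg fun s _ =>
    mul_nonneg (hS _) (hQ20 _ _ _)
  have hU : ∀ u, 0 ≤ pU u := fun u => Finset.sum_nonneg fun s _ => mul_nonneg (hS _) (hQU0 _ _)
  have hU1 : ∑ u, pU u = 1 := by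
    simp only [hpU]; rw [Finset.sum_comm]; simp_rw [← Finset.mul_sum, hQUs, mul_one, hS1]
  have hP1U : ∀ u, ∑ v, P1 u v = pU u := fun u => by
    simp only [hpU, hP1]; rw [Finset.sum_comm]; simp_rw [← Finset.mul_sum]; rfl
  have hP2U : ∀ u, ∑ v, P2 u v = pU u := fun u => by
    simp only [hpU, hP2]; rw [Finset.sum_comm]; simp_rw [← Finset.mul_sum, hQU2]
  obtain ⟨k1, hk10, hk11, hk1P'⟩ := ker_exists P1 hP10
  obtain ⟨k2, hk20, hk21, hk2P'⟩ := ker_exists P2 hP20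
  have hk1P : ∀ u v, P1 u v = pU u * k1 u v := fun u v => by rw [hk1P', hP1U]
  have hk2P : ∀ u v, P2 u v = pU u * k2 u v := fun u v => by rw [hk2P', hP2U]
  have pos : ∀ s u v w x, 0 < pS s → 0 < r s u v w x → 0 < q s u v w ∧ 0 < Q1 s u v ∧
      0 < Q2 s u w ∧ 0 < QU s u ∧ 0 < P1 u v ∧ 0 < P2 u w ∧ 0 < pU u ∧ 0 < k1 u v ∧
      0 < k2 u w := by
    intro s u v w x hs hx
    have a1 := hx.trans_le (hqr s u v w x)
    have a2 := a1.trans_le (hqQ1 s u v w)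
    have a3 := a1.trans_le (hqQ2 s u v w)
    have a4 := a2.trans_le (hQQ1 s u v)
    have a5 : 0 < P1 u v := (mul_pos hs a2).trans_le (Finset.single_le_sum
      (f := fun s => pS s * Q1 s u v) (fun s _ => mul_nonneg (hS _) (hQ10 _ _ _)) (Finset.mem_univ s))
    have a6 : 0 < P2 u w := (mul_pos hs a3).trans_le (Finset.single_le_sum
      (f := fun s => pS s * Q2 s u w) (fun s _ => mul_nonneg (hS _) (hQ20 _ _ _)) (Finset.mem_univ s))
    have a7 : 0 < pU u := (mul_pos hs a4).trans_le (Finset.single_le_sum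
      (f := fun s => pS s * QU s u) (fun s _ => mul_nonneg (hS _) (hQU0 _ _)) (Finset.mem_univ s))
    refine ⟨a1, a2, a3, a4, a5, a6, a7, ?_, ?_⟩
    · rw [hk1P] at a5; exact pos_of_mul_pos_right a5 (hU u)
    · rw [hk2P] at a6; exact pos_of_mul_pos_right a6 (hU u)
  set μ : S × U × V1 × V2 × X → ℝ := fun z =>
    pS z.1 * r z.1 z.2.1 z.2.2.1 z.2.2.2.1 z.2.2.2.2 with hμ
  have hμ0 : ∀ z, 0 ≤ μ z := fun z => mul_nonneg (hS _) (hr _ _ _ _ _)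
  have hμ1 : ∑ z, μ z = 1 := by
    simp_rw [hμ, Fintype.sum_prod_type, ← Finset.mul_sum, hr1, mul_one, hS1]
  have hpos : ∀ z, 0 < μ z → 0 < pS z.1 ∧ 0 < r z.1 z.2.1 z.2.2.1 z.2.2.2.1 z.2.2.2.2 := by
    intro z h
    exact ⟨pos_of_mul_pos_left h (hr _ _ _ _ _), pos_of_mul_pos_right h (hS _)⟩

  set m1 : U → V1 → Y → ℝ := fun u v y => ∑ o : V2, ∑ s, ∑ x, pS s * r s u v o x * W1 x s y with hm1
  have hm10 : ∀ u v y, 0 ≤ m1 u v y := fun u v y => Finset.sum_nonneg fun o _ =>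
    Finset.sum_nonneg fun s _ => Finset.sum_nonneg fun x _ =>
      mul_nonneg (mul_nonneg (hS _) (hr _ _ _ _ _)) (hW10 _ _ _)
  have hm1Y : ∀ u v y, m1 u v y ≤ ∑ u, ∑ v, m1 u v y := fun u v y =>
    (Finset.single_le_sum (f := fun v => m1 u v y) (fun v _ => hm10 u v y)
      (Finset.mem_univ v)).trans
    (Finset.single_le_sum (f := fun u => ∑ v, m1 u v y)
      (fun u _ => Finset.sum_nonneg fun v _ => hm10 u v y) (Finset.mem_univ u))
  have hm1P : ∀ u v, ∑ y, m1 u v y = P1 u v := by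
    intro u v
    simp only [hm1]
    rw [comm4']
    simp_rw [← Finset.mul_sum, hW11, mul_one, ← Finset.mul_sum]
    rw [hP1]
    exact Finset.sum_congr rfl fun s _ => by simp only [hQ1, hq]
  have hm1le : ∀ u v y, m1 u v y ≤ P1 u v := fun u v y => by
    rw [← hm1P]
    exact Finset.single_le_sum (f := fun y => m1 u v y) (fun y _ => hm10 u v y) (Finset.mem_univ y)

  set m2 : U → V2 → Y → ℝ := fun u v y => ∑ o : V1, ∑ s, ∑ x, pS s * r s u o v x * W2 x s y with hm2
  have hm20 : ∀ u v y, 0 ≤ m2 u v y := fun u v y => Finset.sum_nonneg fun o _ =>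
    Finset.sum_nonneg fun s _ => Finset.sum_nonneg fun x _ =>
      mul_nonneg (mul_nonneg (hS _) (hr _ _ _ _ _)) (hW20 _ _ _)
  have hm2Y : ∀ u v y, m2 u v y ≤ ∑ u, ∑ v, m2 u v y := fun u v y =>
    (Finset.single_le_sum (f := fun v => m2 u v y) (fun v _ => hm20 u v y)
      (Finset.mem_univ v)).trans
    (Finset.single_le_sum (f := fun u => ∑ v, m2 u v y)
      (fun u _ => Finset.sum_nonneg fun v _ => hm20 u v y) (Finset.mem_univ u))
  have hm2P : ∀ u v, ∑ y, m2 u v y = P2 u v := by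
    intro u v
    simp only [hm2]
    rw [comm4']
    simp_rw [← Finset.mul_sum, hW21, mul_one, ← Finset.mul_sum]
    rw [hP2]
    exact Finset.sum_congr rfl fun s _ => by simp only [hQ2, hq]
  have hm2le : ∀ u v y, m2 u v y ≤ P2 u v := fun u v y => by
    rw [← hm2P]
    exact Finset.single_le_sum (f := fun y => m2 u v y) (fun y _ => hm20 u v y) (Finset.mem_univ y)

  set d0 : S → U → ℝ := fun s u => Real.log (QU s u / pU u) with hd0
  set d1 : S → U → V1 → ℝ := fun s u v => Real.log ((pS s * Q1 s u v) / (P1 u v * pS s)) with hd1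
  set d2 : S → U → V2 → ℝ := fun s u v => Real.log ((pS s * Q2 s u v) / (P2 u v * pS s)) with hd2
  set dc : S → U → V1 → V2 → ℝ := fun s u v w => Real.log ((pS s * q s u v w) * (pS s * QU s u) /
    ((pS s * Q1 s u v) * (pS s * Q2 s u w))) with hdc
  have ex0 : ∀ s u v w x, 0 < pS s → 0 < r s u v w x → Real.exp (d0 s u) = QU s u / pU u := by
    intro s u v w x hs hx
    obtain ⟨a1, a2, a3, a4, a5, a6, a7, a8, a9⟩ := pos s u v w x hs hx
    simp only [hd0]; rw [Real.exp_log (by positivity)]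
  have ex1 : ∀ s u v w x, 0 < pS s → 0 < r s u v w x →
      Real.exp (d1 s u v) = Q1 s u v / (pU u * k1 u v) := by
    intro s u v w x hs hx
    obtain ⟨a1, a2, a3, a4, a5, a6, a7, a8, a9⟩ := pos s u v w x hs hx
    simp only [hd1]; rw [Real.exp_log (by positivity), ← hk1P]; field_simp
  have ex2 : ∀ s u v w x, 0 < pS s → 0 < r s u v w x →
      Real.exp (d2 s u w) = Q2 s u w / (pU u * k2 u w) := by
    intro s u v w x hs hx
    obtain ⟨a1, a2, a3, a4, a5, a6, a7, a8, a9⟩ := pos s u v w x hs hx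
    simp only [hd2]; rw [Real.exp_log (by positivity), ← hk2P]; field_simp
  have exc : ∀ s u v w x, 0 < pS s → 0 < r s u v w x →
      Real.exp (dc s u v w) = q s u v w * QU s u / (Q1 s u v * Q2 s u w) := by
    intro s u v w x hs hx
    obtain ⟨a1, a2, a3, a4, a5, a6, a7, a8, a9⟩ := pos s u v w x hs hx
    simp only [hdc]; rw [Real.exp_log (by positivity)]; field_simp
  obtain ⟨V, hV, hblk⟩ := blockcode hS hS1 hW10 hW20 hW11 hW21 hU hk10 hk20 hU1 hk11 hk21 hr hr1 hq
    (μ := μ) (fun z => rfl) d0 d1 d2 dc rfl rfl rfl rfl (by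
      intro s u v w x hs hx
      obtain ⟨a1, a2, a3, a4, a5, a6, a7, a8, a9⟩ := pos s u v w x hs hx
      rw [ex0 s u v w x hs hx]; field_simp; rfl) (by
      intro s u v w x hs hx
      obtain ⟨a1, a2, a3, a4, a5, a6, a7, a8, a9⟩ := pos s u v w x hs hx
      rw [ex1 s u v w x hs hx]; field_simp; rfl) (by
      intro s u v w x hs hx
      obtain ⟨a1, a2, a3, a4, a5, a6, a7, a8, a9⟩ := pos s u v w x hs hx
      rw [ex2 s u v w x hs hx]; field_simp; rfl) (by
      intro s u v w x hs hx
      obtain ⟨a1, a2, a3, a4, a5, a6, a7, a8, a9⟩ := pos s u v w x hs hx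
      rw [Real.exp_add, Real.exp_sub, Real.exp_add, ex0 s u v w x hs hx, ex1 s u v w x hs hx,
        ex2 s u v w x hs hx, exc s u v w x hs hx]; field_simp)
    (fun u v y => 0 < m1 u v y)
    (fun u v y => Real.log (m1 u v y / (P1 u v * ∑ u, ∑ v, m1 u v y)))
    (fun u v y => m1 u v y / ∑ u, ∑ v, m1 u v y) (fun u v y => div_nonneg (hm10 _ _ _)
      (Finset.sum_nonneg fun u _ => Finset.sum_nonneg fun v _ => hm10 _ _ _)) (by
        intro y
        simp_rw [← Finset.sum_div]
        exact div_self_le_one _) (by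
        intro u v y h
        have a := hm1Y u v y
        have b := hm1le u v y
        have a' := h.trans_le a
        have b' := h.trans_le b
        rw [Real.exp_log (by positivity), ← hk1P]
        field_simp) (by
        intro s u v w x y h h'
        have hh := mul_pos h h'
        refine hh.trans_le ?_
        simp only [hm1]
        refine le_trans ?_ (Finset.single_le_sum (f := fun o => ∑ s, ∑ x, pS s * r s u v o x * W1 x s y)
          (fun o _ => Finset.sum_nonneg fun s _ => Finset.sum_nonneg fun x _ =>
            mul_nonneg (mul_nonneg (hS _) (hr _ _ _ _ _)) (hW10 _ _ _)) (Finset.mem_univ w))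
        refine le_trans ?_ (Finset.single_le_sum (f := fun s => ∑ x, pS s * r s u v w x * W1 x s y)
          (fun s _ => Finset.sum_nonneg fun x _ =>
            mul_nonneg (mul_nonneg (hS _) (hr _ _ _ _ _)) (hW10 _ _ _)) (Finset.mem_univ s))
        exact Finset.single_le_sum (f := fun x => pS s * r s u v w x * W1 x s y)
          (fun x _ =>
            mul_nonneg (mul_nonneg (hS _) (hr _ _ _ _ _)) (hW10 _ _ _)) (Finset.mem_univ x)) rfl
    (fun u v y => 0 < m2 u v y)
    (fun u v y => Real.log (m2 u v y / (P2 u v * ∑ u, ∑ v, m2 u v y)))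
    (fun u v y => m2 u v y / ∑ u, ∑ v, m2 u v y) (fun u v y => div_nonneg (hm20 _ _ _)
      (Finset.sum_nonneg fun u _ => Finset.sum_nonneg fun v _ => hm20 _ _ _)) (by
        intro y
        simp_rw [← Finset.sum_div]
        exact div_self_le_one _) (by
        intro u v y h
        have a := hm2Y u v y
        have b := hm2le u v y
        have a' := h.trans_le a
        have b' := h.trans_le b
        rw [Real.exp_log (by positivity), ← hk2P]
        field_simp) (by
        intro s u v w x y h h'
        have hh := mul_pos h h'
        refine hh.trans_le ?_
        simp only [hm2]
        refine le_trans ?_ (Finset.single_le_sum (f := fun o => ∑ s, ∑ x, pS s * r s u o w x * W2 x s y)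
          (fun o _ => Finset.sum_nonneg fun s _ => Finset.sum_nonneg fun x _ =>
            mul_nonneg (mul_nonneg (hS _) (hr _ _ _ _ _)) (hW20 _ _ _)) (Finset.mem_univ v))
        refine le_trans ?_ (Finset.single_le_sum (f := fun s => ∑ x, pS s * r s u v w x * W2 x s y)
          (fun s _ => Finset.sum_nonneg fun x _ =>
            mul_nonneg (mul_nonneg (hS _) (hr _ _ _ _ _)) (hW20 _ _ _)) (Finset.mem_univ s))
        exact Finset.single_le_sum (f := fun x => pS s * r s u v w x * W2 x s y)
          (fun x _ =>
            mul_nonneg (mul_nonneg (hS _) (hr _ _ _ _ _)) (hW20 _ _ _)) (Finset.mem_univ x)) rfl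
  refine ⟨_, _, _, _, _, _, V, ?_, ?_, ?_, ?_, hV, rfl, rfl, rfl, rfl, rfl, hblk⟩
  · refine gibbs hμ0 hμ1 (ν := fun z => pS z.1 * (pU z.2.1 *
      (r z.1 z.2.1 z.2.2.1 z.2.2.2.1 z.2.2.2.2 / QU z.1 z.2.1))) (fun z => mul_nonneg (hS _)
        (mul_nonneg (hU _) (div_nonneg (hr _ _ _ _ _) (hQU0 _ _)))) ?_ _ ?_
    · simp only [Fintype.sum_prod_type, ← Finset.mul_sum, ← Finset.sum_div, ← hq]
      calc ∑ s, pS s * ∑ u, pU u * (QU s u / QU s u) ≤ ∑ s, pS s * ∑ u, pU u * 1 := by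
            refine Finset.sum_le_sum fun s _ => mul_le_mul_of_nonneg_left
              (Finset.sum_le_sum fun u _ => mul_le_mul_of_nonneg_left (div_self_le_one _) (hU _)) (hS _)
        _ = 1 := by simp [hU1, hS1]
    · intro z hz
      obtain ⟨hs, hx⟩ := hpos z hz
      obtain ⟨a1, a2, a3, a4, a5, a6, a7, a8, a9⟩ := pos _ _ _ _ _ hs hx
      rw [Real.exp_neg, ex0 _ _ _ _ _ hs hx]
      simp only [hμ]
      apply le_of_eq
      field_simp
  · suffices h : 0 ≤ ∑ z, μ z * (d1 z.1 z.2.1 z.2.2.1 - d0 z.1 z.2.1) by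
      simp only [mul_sub, Finset.sum_sub_distrib] at h
      exact sub_nonneg.1 h
    refine gibbs hμ0 hμ1 (ν := fun z => pS z.1 * (QU z.1 z.2.1 * (k1 z.2.1 z.2.2.1 *
      (r z.1 z.2.1 z.2.2.1 z.2.2.2.1 z.2.2.2.2 / Q1 z.1 z.2.1 z.2.2.1)))) (fun z => mul_nonneg (hS _)
        (mul_nonneg (hQU0 _ _) (mul_nonneg (hk10 _ _) (div_nonneg (hr _ _ _ _ _) (hQ10 _ _ _)))))
        ?_ _ ?_
    · simp only [Fintype.sum_prod_type, ← Finset.mul_sum, ← Finset.sum_div, ← hq]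
      calc ∑ s, pS s * ∑ u, QU s u * ∑ v, k1 u v * (Q1 s u v / Q1 s u v)
          ≤ ∑ s, pS s * ∑ u, QU s u * ∑ v, k1 u v * 1 := by
            refine Finset.sum_le_sum fun s _ => mul_le_mul_of_nonneg_left
              (Finset.sum_le_sum fun u _ => mul_le_mul_of_nonneg_left
                (Finset.sum_le_sum fun v _ => mul_le_mul_of_nonneg_left (div_self_le_one _)
                  (hk10 _ _)) (hQU0 _ _)) (hS _)
        _ = 1 := by simp only [mul_one, hk11, hQUs, hS1]
    · intro z hz
      obtain ⟨hs, hx⟩ := hpos z hz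
      obtain ⟨a1, a2, a3, a4, a5, a6, a7, a8, a9⟩ := pos _ _ _ _ _ hs hx
      rw [neg_sub, Real.exp_sub, ex0 _ _ _ _ _ hs hx, ex1 _ _ _ _ _ hs hx]
      simp only [hμ]
      apply le_of_eq
      field_simp
  · suffices h : 0 ≤ ∑ z, μ z * (d2 z.1 z.2.1 z.2.2.2.1 - d0 z.1 z.2.1) by
      simp only [mul_sub, Finset.sum_sub_distrib] at h
      exact sub_nonneg.1 h
    refine gibbs hμ0 hμ1 (ν := fun z => pS z.1 * (QU z.1 z.2.1 * (k2 z.2.1 z.2.2.2.1 *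
      (r z.1 z.2.1 z.2.2.1 z.2.2.2.1 z.2.2.2.2 / Q2 z.1 z.2.1 z.2.2.2.1)))) (fun z => mul_nonneg
        (hS _) (mul_nonneg (hQU0 _ _) (mul_nonneg (hk20 _ _) (div_nonneg (hr _ _ _ _ _)
        (hQ20 _ _ _))))) ?_ _ ?_
    · simp only [Fintype.sum_prod_type, ← Finset.mul_sum, ← Finset.sum_div, ← hq]
      simp_rw [Finset.sum_comm (s := (Finset.univ : Finset V1)), ← Finset.mul_sum,
        ← Finset.sum_div]
      calc ∑ s, pS s * ∑ u, QU s u * ∑ v, k2 u v * (Q2 s u v / Q2 s u v)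
          ≤ ∑ s, pS s * ∑ u, QU s u * ∑ v, k2 u v * 1 := by
            refine Finset.sum_le_sum fun s _ => mul_le_mul_of_nonneg_left
              (Finset.sum_le_sum fun u _ => mul_le_mul_of_nonneg_left
                (Finset.sum_le_sum fun v _ => mul_le_mul_of_nonneg_left (div_self_le_one _)
                  (hk20 _ _)) (hQU0 _ _)) (hS _)
        _ = 1 := by simp only [mul_one, hk21, hQUs, hS1]
    · intro z hz
      obtain ⟨hs, hx⟩ := hpos z hz
      obtain ⟨a1, a2, a3, a4, a5, a6, a7, a8, a9⟩ := pos _ _ _ _ _ hs hx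
      rw [neg_sub, Real.exp_sub, ex0 _ _ _ _ _ hs hx, ex2 _ _ _ _ _ hs hx]
      simp only [hμ]
      apply le_of_eq
      field_simp
  · refine gibbs hμ0 hμ1 (ν := fun z => pS z.1 * ((Q1 z.1 z.2.1 z.2.2.1 * (Q2 z.1 z.2.1 z.2.2.2.1 *
      (r z.1 z.2.1 z.2.2.1 z.2.2.2.1 z.2.2.2.2 / q z.1 z.2.1 z.2.2.1 z.2.2.2.1))) / QU z.1 z.2.1))
      (fun z => mul_nonneg (hS _) (div_nonneg (mul_nonneg (hQ10 _ _ _) (mul_nonneg (hQ20 _ _ _)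
        (div_nonneg (hr _ _ _ _ _) (hq0 _ _ _ _)))) (hQU0 _ _))) ?_ _ ?_
    · simp only [Fintype.sum_prod_type, ← Finset.mul_sum, ← Finset.sum_div, ← hq]
      calc ∑ s, pS s * ∑ u, (∑ v, Q1 s u v * ∑ w, Q2 s u w * (q s u v w / q s u v w)) / QU s u
          ≤ ∑ s, pS s * ∑ u, (∑ v, Q1 s u v * ∑ w, Q2 s u w * 1) / QU s u := by
            refine Finset.sum_le_sum fun s _ => mul_le_mul_of_nonneg_left
              (Finset.sum_le_sum fun u _ => div_le_div_of_nonneg_right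
                (Finset.sum_le_sum fun v _ => mul_le_mul_of_nonneg_left
                  (Finset.sum_le_sum fun w _ => mul_le_mul_of_nonneg_left (div_self_le_one _)
                  (hQ20 _ _ _)) (hQ10 _ _ _)) (hQU0 _ _)) (hS _)
        _ = ∑ s, pS s * ∑ u, (QU s u * QU s u) / QU s u := by
            simp only [mul_one, hQU2, ← Finset.sum_mul]; rfl
        _ = 1 := by simp only [mul_self_div_self, hQUs, mul_one, hS1]
    · intro z hz
      obtain ⟨hs, hx⟩ := hpos z hz
      obtain ⟨a1, a2, a3, a4, a5, a6, a7, a8, a9⟩ := pos _ _ _ _ _ hs hx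
      rw [Real.exp_neg, exc _ _ _ _ _ hs hx]
      simp only [hμ]
      apply le_of_eq
      field_simp

lemma ceil_exp {x : ℝ} (hx : 0 ≤ x) : ∃ L : ℕ, 0 < L ∧ Real.exp x ≤ L ∧ (L : ℝ) ≤ 2 * Real.exp x := by
  refine ⟨⌈Real.exp x⌉₊, Nat.ceil_pos.2 (Real.exp_pos x), Nat.le_ceil _, ?_⟩
  have h1 := (Nat.ceil_lt_add_one (Real.exp_nonneg x)).le
  have h2 := Real.one_le_exp hx
  linarith

lemma exp_neg_le_inv {x : ℝ} (hx : 0 < x) : Real.exp (-x) ≤ 1 / x := by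
  rw [Real.exp_neg, ← one_div]
  have := Real.add_one_le_exp x
  exact one_div_le_one_div_of_le hx (by linarith)

lemma div_exp_le {a b c x : ℝ} (hb : Real.exp b ≤ x) (h : a - b ≤ c) :
    Real.exp a / x ≤ Real.exp c := by
  have hx : 0 < x := (Real.exp_pos b).trans_le hb
  rw [div_le_iff₀ hx]
  calc Real.exp a = Real.exp (a - b) * Real.exp b := by rw [← Real.exp_add]; congr 1; ring
    _ ≤ Real.exp c * x := by gcongr

lemma rate {S X Y : Type} [Fintype S] [Fintype Y] {pS : S → ℝ} {W1 W2 : X → S → Y → ℝ}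
    {I0 I1 I2 Ic J1 J2 V R : ℝ} (hB : BlockProp pS W1 W2 I0 I1 I2 Ic J1 J2 V)
    (h0 : 0 ≤ I0) (h1 : I0 ≤ I1) (h2 : I0 ≤ I2) (hc : 0 ≤ Ic) (hV : 0 ≤ V) (hR : 0 < R)
    (hR1 : R ≤ J1 - I1) (hR2 : R ≤ J2 - I2) (hR3 : R ≤ (J1 - I1 + (J2 - I2) - Ic) / 2)
    {ε γ : ℝ} (hε : 0 < ε) (hγ : 0 < γ) :
    ∃ n₀ : ℕ, ∀ n ≥ n₀, ∃ M : ℕ, 1 ≤ M ∧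
        ∃ (φ : Fin M → (Fin n → S) → (Fin n → X)) (ψ : (Fin n → Y) → Fin M),
          Real.log M / n ≥ R - γ ∧ ∀ m,
      (∑ s : Fin n → S, (∏ i, pS (s i)) * ∑ y : Fin n → Y,
        (∏ i, W1 (φ m s i) (s i) (y i)) * (if ψ y ≠ m then 1 else 0)) ≤ ε ∧
      (∑ s : Fin n → S, (∏ i, pS (s i)) * ∑ y : Fin n → Y,
        (∏ i, W2 (φ m s i) (s i) (y i)) * (if ψ y ≠ m then 1 else 0)) ≤ ε := by
  obtain ⟨a, b, ha, hb, hab, ha1, hb1⟩ : ∃ a b : ℝ, 0 ≤ a ∧ 0 ≤ b ∧ a + b = Ic ∧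
      a ≤ J1 - I1 - R ∧ b ≤ J2 - I2 - R := by
    refine ⟨max 0 (Ic - (J2 - I2 - R)), Ic - max 0 (Ic - (J2 - I2 - R)), le_max_left _ _, ?_, by ring,
      max_le (by linarith) (by linarith), ?_⟩
    · rw [sub_nonneg]; exact max_le hc (by linarith)
    · have := le_max_right 0 (Ic - (J2 - I2 - R)); linarith
  obtain ⟨δ, hδ, hδR, hδγ⟩ : ∃ δ : ℝ, 0 < δ ∧ 6 * δ ≤ R ∧ 6 * δ ≤ γ / 2 := by
    refine ⟨min (R / 6) (γ / 12), lt_min (by linarith) (by linarith), ?_, ?_⟩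
    · have := min_le_left (R / 6) (γ / 12); linarith
    · have := min_le_right (R / 6) (γ / 12); linarith
  obtain ⟨η, hη⟩ : ∃ η, η = ε / 4 := ⟨_, rfl⟩
  have hη0 : 0 < η := by rw [hη]; linarith
  set C : ℝ := 8 * (V / δ ^ 2) + 4 * (V / δ ^ 2) / η + 42 / δ with hC
  refine ⟨⌈4 * C / ε⌉₊ + ⌈2 / γ⌉₊ + 1, fun n hn => ?_⟩
  have hn0 : 0 < n := by omega
  have hn' : (0 : ℝ) < n := by exact_mod_cast hn0
  have hnC : 4 * C / ε ≤ n := (Nat.le_ceil _).trans (by exact_mod_cast (by omega))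
  have hnγ : 2 / γ ≤ n := (Nat.le_ceil _).trans (by exact_mod_cast (by omega))
  have hnn : ∀ x : ℝ, 0 ≤ x → 0 ≤ n * x := fun x hx => mul_nonneg hn'.le hx
  obtain ⟨L0, l0, l0a, l0b⟩ := ceil_exp (hnn (I0 + 2 * δ) (by linarith))
  obtain ⟨L1, l1, l1a, l1b⟩ := ceil_exp (hnn (I1 - I0 + a + 2 * δ) (by linarith))
  obtain ⟨L2, l2, l2a, l2b⟩ := ceil_exp (hnn (I2 - I0 + b + 2 * δ) (by linarith))
  obtain ⟨N, lN, lNa, lNb⟩ := ceil_exp (hnn (R - 6 * δ) (by linarith))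
  set e := Real.exp (-(n * δ)) with he
  have he0 : 0 ≤ e := Real.exp_nonneg _
  have hle : ∀ x y : ℝ, x ≤ y → n * x ≤ n * y := fun x y h => mul_le_mul_of_nonneg_left h hn'.le
  have mulx : ∀ {x y p q : ℝ}, Real.exp x ≤ p → Real.exp y ≤ q → Real.exp (x + y) ≤ p * q := by
    intro x y p q hp hq
    rw [Real.exp_add]
    exact mul_le_mul hp hq (Real.exp_nonneg _) ((Real.exp_nonneg _).trans hp)
  have cov : (1 + Real.exp (n * (I0 + δ)) + Real.exp (n * (I1 + δ)) / L1
          + Real.exp (n * (I2 + δ)) / L2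
          + Real.exp (n * (I1 + I2 - I0 + Ic + 4 * δ)) / (L1 * L2)) / L0 ≤ 5 * e := by
    have t0 : Real.exp 0 / L0 ≤ e := div_exp_le l0a (by
      have := hle (-(I0 + 2 * δ)) (-δ) (by linarith); linarith)
    have t1 : Real.exp (n * (I0 + δ)) / L0 ≤ e := div_exp_le l0a (by
      have := hle (I0 + δ - (I0 + 2 * δ)) (-δ) (by linarith); linarith)
    have t2 : Real.exp (n * (I1 + δ)) / (L1 * L0) ≤ e := div_exp_le (mulx l1a l0a) (by
      have := hle (I1 + δ - (I1 - I0 + a + 2 * δ + (I0 + 2 * δ))) (-δ) (by linarith); linarith)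
    have t3 : Real.exp (n * (I2 + δ)) / (L2 * L0) ≤ e := div_exp_le (mulx l2a l0a) (by
      have := hle (I2 + δ - (I2 - I0 + b + 2 * δ + (I0 + 2 * δ))) (-δ) (by linarith); linarith)
    have t4 : Real.exp (n * (I1 + I2 - I0 + Ic + 4 * δ)) / (L1 * L2 * L0) ≤ e :=
      div_exp_le (mulx (mulx l1a l2a) l0a) (by
      have := hle (I1 + I2 - I0 + Ic + 4 * δ - (I1 - I0 + a + 2 * δ + (I2 - I0 + b + 2 * δ)
        + (I0 + 2 * δ))) (-δ) (by linarith)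
      linarith)
    rw [Real.exp_zero] at t0
    simp only [add_div, div_div]
    linarith
  have pk : ∀ (L : ℕ) (J I c : ℝ), (L : ℝ) ≤ 2 * Real.exp (n * (I - I0 + c + 2 * δ)) →
      c ≤ J - I - R → N * (2 * (L0 * (L * Real.exp (-(n * (J - δ)))))) ≤ 16 * e := by
    intro L J I c hL hcc
    calc (N : ℝ) * (2 * (L0 * (L * Real.exp (-(n * (J - δ))))))
        ≤ (2 * Real.exp (n * (R - 6 * δ))) * (2 * ((2 * Real.exp (n * (I0 + 2 * δ))) *
          ((2 * Real.exp (n * (I - I0 + c + 2 * δ))) * Real.exp (-(n * (J - δ)))))) := by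
          gcongr
      _ = 16 * (Real.exp (n * (R - 6 * δ)) * (Real.exp (n * (I0 + 2 * δ)) *
          (Real.exp (n * (I - I0 + c + 2 * δ)) * Real.exp (-(n * (J - δ)))))) := by ring
      _ = 16 * Real.exp (n * (R - 6 * δ) + (n * (I0 + 2 * δ) +
          (n * (I - I0 + c + 2 * δ) + -(n * (J - δ))))) := by simp only [Real.exp_add]
      _ ≤ 16 * e := by
          rw [he]
          gcongr
          have := hle (R - 6 * δ + (I0 + 2 * δ + (I - I0 + c + 2 * δ - (J - δ)))) (-δ) (by linarith)
          linarith
  have pk1 := pk L1 J1 I1 a l1b ha1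
  have pk2 := pk L2 J2 I2 b l2b hb1
  have hee : e ≤ 1 / (n * δ) := exp_neg_le_inv (by positivity)
  have htot : η + 2 * ((4 * (V / (n * δ ^ 2)) + (2 * (V / (n * δ ^ 2))) / η)
        + (1 + Real.exp (n * (I0 + δ)) + Real.exp (n * (I1 + δ)) / L1
          + Real.exp (n * (I2 + δ)) / L2
          + Real.exp (n * (I1 + I2 - I0 + Ic + 4 * δ)) / (L1 * L2)) / L0)
        + N * (2 * (L0 * (L1 * Real.exp (-(n * (J1 - δ))) + L2 * Real.exp (-(n * (J2 - δ))))))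
        ≤ ε / 2 := by
    have hCn : C / n ≤ ε / 4 := by
      rw [div_le_iff₀ hε] at hnC
      rw [div_le_iff₀ hn']; linarith
    have hCe : C / n = 2 * (4 * (V / (n * δ ^ 2)) + (2 * (V / (n * δ ^ 2))) / η)
        + 42 * (1 / (n * δ)) := by
      rw [hC]; field_simp; ring
    have hsplit : (N : ℝ) * (2 * (L0 * (L1 * Real.exp (-(n * (J1 - δ))) +
        L2 * Real.exp (-(n * (J2 - δ)))))) = N * (2 * (L0 * (L1 * Real.exp (-(n * (J1 - δ))))))
        + N * (2 * (L0 * (L2 * Real.exp (-(n * (J2 - δ)))))) := by ring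
    rw [hsplit]
    linarith
  obtain ⟨M, hM, φ, ψ, hφ⟩ := hB n hn0 δ hδ η hη0 L0 L1 L2 N l0 l1 l2 lN (ε / 2) (by linarith) htot
  have hM1 : 1 ≤ M := by omega
  refine ⟨M, hM1, φ, ψ, ?_, fun m => ⟨(hφ m).1.trans (by linarith), (hφ m).2.trans (by linarith)⟩⟩
  have hMr : (N : ℝ) ≤ 2 * M := by exact_mod_cast hM
  have hM0 : (0 : ℝ) < M := by exact_mod_cast hM1
  have hlog : n * (R - 6 * δ) ≤ Real.log 2 + Real.log M := by
    rw [← Real.log_mul (by norm_num) hM0.ne', Real.le_log_iff_exp_le (by positivity)]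
    linarith
  have hl2 : Real.log 2 ≤ 1 := by have := Real.log_two_lt_d9; linarith
  rw [ge_iff_le, le_div_iff₀ hn']
  rw [div_le_iff₀ hγ] at hnγ
  have := hle (6 * δ) (γ / 2) hδγ
  linarith

lemma pmf_sum {A : Type} [Fintype A] (p : PMF A) : ∑ a, (p a).toReal = 1 := by
  rw [← ENNReal.toReal_sum (fun a _ => p.apply_ne_top a), ← tsum_fintype (L := SummationFilter.unconditional _), p.tsum_coe]
  simp

/-- New lower bound (Theorem 2) for the two-component compound DMC
`{W₁, W₂}` with states known non-causally at the transmitter only: for any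
conditional input distribution `P : 𝒮 → PMF (𝒳 × 𝒰 × 𝒱₁ × 𝒱₂)` the rate
`max(0, min{ I(U,V₁;Y₁) − I(U,V₁;S), I(U,V₂;Y₂) − I(U,V₂;S),
½[I(U,V₁;Y₁) − I(U,V₁;S) + I(U,V₂;Y₂) − I(U,V₂;S) − I(V₁;V₂|U,S)] })`
is achievable, all informations being computed from
`p_θ(u,v₁,v₂,s,x,y) = P_S(s)·P(s)(x,u,v₁,v₂)·(W_θ x s)(y)`. -/
theorem two_component_lower_bound
    {𝒰 𝒱₁ 𝒱₂ : Type} [Fintype 𝒰] [Nonempty 𝒰] [Fintype 𝒱₁] [Nonempty 𝒱₁]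
    [Fintype 𝒱₂] [Nonempty 𝒱₂]
    (W₁ W₂ : 𝒳 → 𝒮 → PMF 𝒴) (PS : PMF 𝒮) (P : 𝒮 → PMF (𝒳 × 𝒰 × 𝒱₁ × 𝒱₂)) :
    -- `I(U,V₁;Y₁) − I(U,V₁;S)` computed from `p₁`
    let r₁ : ℝ :=
      mutualInfo (fun q : (𝒰 × 𝒱₁) × 𝒴 =>
        ∑ v₂ : 𝒱₂, ∑ s : 𝒮, ∑ x : 𝒳,
          joint W₁ PS P (q.1.1, q.1.2, v₂, s, x, q.2)) -
      mutualInfo (fun q : (𝒰 × 𝒱₁) × 𝒮 =>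
        ∑ v₂ : 𝒱₂, ∑ x : 𝒳, ∑ y : 𝒴,
          joint W₁ PS P (q.1.1, q.1.2, v₂, q.2, x, y));
    -- `I(U,V₂;Y₂) − I(U,V₂;S)` computed from `p₂`
    let r₂ : ℝ :=
      mutualInfo (fun q : (𝒰 × 𝒱₂) × 𝒴 =>
        ∑ v₁ : 𝒱₁, ∑ s : 𝒮, ∑ x : 𝒳,
          joint W₂ PS P (q.1.1, v₁, q.1.2, s, x, q.2)) -
      mutualInfo (fun q : (𝒰 × 𝒱₂) × 𝒮 =>
        ∑ v₁ : 𝒱₁, ∑ x : 𝒳, ∑ y : 𝒴,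
          joint W₂ PS P (q.1.1, v₁, q.1.2, q.2, x, y));
    -- `I(V₁;V₂|U,S)` (does not involve `Y`, hence does not depend on `θ`)
    let r₁₂ : ℝ :=
      condMutualInfo (fun q : 𝒱₁ × 𝒱₂ × (𝒰 × 𝒮) =>
        ∑ x : 𝒳, ∑ y : 𝒴,
          joint W₁ PS P (q.2.2.1, q.1, q.2.1, q.2.2.2, x, y));
    IsAchievable (fun θ : Fin 2 => if θ = 0 then W₁ else W₂) PS
      (max 0 (min r₁ (min r₂ ((r₁ + r₂ - r₁₂) / 2)))) := by
  intro r₁ r₂ r₁₂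
  obtain ⟨s0, -⟩ := PS.support_nonempty
  obtain ⟨z0, -⟩ := (P s0).support_nonempty
  have : Nonempty 𝒳 := ⟨z0.1⟩
  refine ⟨le_max_left _ _, fun ε hε γ hγ => ?_⟩
  by_cases hpos : 0 < min r₁ (min r₂ ((r₁ + r₂ - r₁₂) / 2))
  · rw [max_eq_right hpos.le]
    obtain ⟨I0, I1, I2, Ic, J1, J2, V, h0, h1, h2, hc, hV, e1, e2, e3, e4, e5, hB⟩ :=
      lettercode (pS := fun s => (PS s).toReal) (W1 := fun x s y => (W₁ x s y).toReal)
        (W2 := fun x s y => (W₂ x s y).toReal)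
        (r := fun s u v w x => (P s (x, u, v, w)).toReal)
        (fun _ => ENNReal.toReal_nonneg) (pmf_sum PS) (fun _ _ _ => ENNReal.toReal_nonneg)
        (fun _ _ _ => ENNReal.toReal_nonneg) (fun x s => pmf_sum (W₁ x s))
        (fun x s => pmf_sum (W₂ x s)) (fun _ _ _ _ _ => ENNReal.toReal_nonneg) (by
          intro s
          have h := pmf_sum (P s)
          simp only [Fintype.sum_prod_type] at h
          refine Eq.trans ?_ h
          refine Eq.trans ?_ Finset.sum_comm
          refine Finset.sum_congr rfl fun u _ => ?_
          exact comm3 (fun v w x => (P s (x, u, v, w)).toReal))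
    have q1 : r₁ = J1 - I1 := congrArg₂ (· - ·) e1 e2
    have q2 : r₂ = J2 - I2 := congrArg₂ (· - ·) e3 e4
    have q3 : r₁₂ = Ic := e5
    obtain ⟨n₀, hn⟩ := rate hB h0 h1 h2 hc hV hpos
      (by rw [← q1]; exact min_le_left _ _)
      (by rw [← q2]; exact (min_le_right _ _).trans (min_le_left _ _))
      (by rw [← q1, ← q2, ← q3]; exact (min_le_right _ _).trans (min_le_right _ _)) hε.1 hγ.1
    refine ⟨n₀, fun n hn' => ?_⟩
    obtain ⟨M, hM, φ, ψ, hr, he⟩ := hn n hn'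
    refine ⟨M, hM, φ, ψ, hr, fun m θ => ?_⟩
    unfold avgError
    by_cases hθ : θ = 0
    · simp only [hθ, if_true]; exact (he m).1
    · simp only [hθ, if_false]; exact (he m).2
  · rw [max_eq_left (not_lt.1 hpos)]
    refine ⟨0, fun n _ => ⟨1, le_rfl, fun _ _ _ => z0.1, fun _ => 0, ?_, fun m θ => ?_⟩⟩
    · simp [hγ.1.le]
    · have : ∀ k : Fin 1, k = m := fun k => Subsingleton.elim _ _
      unfold avgError
      simp [← this 0, hε.1.le]

end CompoundTwo
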